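/- arXiv:2207.12778 — 2 statements merged into one kernel-verified Lean document; each statement's English description precedes it below -/
import Mathlib

section
/- Every subsemigroup of an absolutely T₂S-closed commutative semigroup is absolutely T₂S-closed, and every subsemigroup of an absolutely T₁S-closed commutative semigroup is absolutely T₁S-closed. -/
universe u

open Set TopologicalSpace

/-- A topological space is zero-dimensional: it has a base of clopen sets. -/
def HasClopenBasis (Y : Type*) [TopologicalSpace Y] : Prop :=
  ∃ B : Set (Set Y), (∀ s ∈ B, IsClopen s) ∧ IsTopologicalBasis B

section TopClasses

variable (X : Type u) [Semigroup X]

/-- `X` is absolutely `T₁S`-closed: the image of every homomorphism to a `T₁`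
topological semigroup is closed. -/
def AbsolutelyT1SClosed : Prop :=
  ∀ (Y : Type u) [Semigroup Y] [TopologicalSpace Y] [ContinuousMul Y] [T1Space Y]
    (h : X →ₙ* Y), IsClosed (Set.range h)

/-- `X` is absolutely `T₂S`-closed. -/
def AbsolutelyT2SClosed : Prop :=
  ∀ (Y : Type u) [Semigroup Y] [TopologicalSpace Y] [ContinuousMul Y] [T2Space Y]
    (h : X →ₙ* Y), IsClosed (Set.range h)

/-- `X` is absolutely `TzS`-closed. -/
def AbsolutelyTzSClosed : Prop :=
  ∀ (Y : Type u) [Semigroup Y] [TopologicalSpace Y] [ContinuousMul Y] [T1Space Y],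
    HasClopenBasis Y → ∀ (h : X →ₙ* Y), IsClosed (Set.range h)

/-- `X` is `T₁S`-closed: the image of every injective homomorphism to a `T₁`
topological semigroup with discrete image is closed. -/
def T1SClosed : Prop :=
  ∀ (Y : Type u) [Semigroup Y] [TopologicalSpace Y] [ContinuousMul Y] [T1Space Y]
    (h : X →ₙ* Y), Function.Injective h → DiscreteTopology (Set.range h) →
      IsClosed (Set.range h)

/-- `X` is `T₂S`-closed. -/
def T2SClosed : Prop :=
  ∀ (Y : Type u) [Semigroup Y] [TopologicalSpace Y] [ContinuousMul Y] [T2Space Y]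
    (h : X →ₙ* Y), Function.Injective h → DiscreteTopology (Set.range h) →
      IsClosed (Set.range h)

/-- `X` is `TzS`-closed. -/
def TzSClosed : Prop :=
  ∀ (Y : Type u) [Semigroup Y] [TopologicalSpace Y] [ContinuousMul Y] [T1Space Y],
    HasClopenBasis Y → ∀ (h : X →ₙ* Y), Function.Injective h →
      DiscreteTopology (Set.range h) → IsClosed (Set.range h)

/-- `X` is injectively `T₂S`-closed. -/
def InjectivelyT2SClosed : Prop :=
  ∀ (Y : Type u) [Semigroup Y] [TopologicalSpace Y] [ContinuousMul Y] [T2Space Y]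
    (h : X →ₙ* Y), Function.Injective h → IsClosed (Set.range h)

/-- `X` is projectively `T₁S`-closed: all congruence quotients are `T₁S`-closed. -/
def ProjectivelyT1SClosed : Prop := ∀ c : Con X, T1SClosed c.Quotient

/-- `X` is projectively `TzS`-closed. -/
def ProjectivelyTzSClosed : Prop := ∀ c : Con X, TzSClosed c.Quotient

/-- `X` is projectively `T₁S`-discrete: every homomorphism into a `T₁`
topological semigroup has discrete image. -/
def ProjectivelyT1SDiscrete : Prop :=
  ∀ (Y : Type u) [Semigroup Y] [TopologicalSpace Y] [ContinuousMul Y] [T1Space Y]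
    (h : X →ₙ* Y), DiscreteTopology (Set.range h)

/-- `X` is projectively `TzS`-discrete. -/
def ProjectivelyTzSDiscrete : Prop :=
  ∀ (Y : Type u) [Semigroup Y] [TopologicalSpace Y] [ContinuousMul Y] [T1Space Y],
    HasClopenBasis Y → ∀ (h : X →ₙ* Y), DiscreteTopology (Set.range h)

end TopClasses

/-- `spow x n` is the power `x^(n+1)` in a semigroup; thus as `n` ranges over `ℕ`,
`spow x n` ranges over all powers `x^m`, `m ≥ 1`. -/
def spow {X : Type*} [Semigroup X] (x : X) : ℕ → X
  | 0 => x
  | n + 1 => spow x n * x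

section AlgDefs

variable (X : Type*) [Semigroup X]

/-- the set `E(X)` of idempotents. -/
def idemSet : Set X := {x | x * x = x}

/-- `H_e`, the maximal subgroup containing the idempotent `e`. -/
def maxSubgroup (e : X) : Set X :=
  {x | x * e = x ∧ e * x = x ∧ ∃ y, y * e = y ∧ e * y = y ∧ x * y = e ∧ y * x = e}

/-- The Clifford part `H(X) = ⋃_{e ∈ E(X)} H_e`. -/
def cliffordPart : Set X := ⋃ e ∈ idemSet X, maxSubgroup X e

/-- `H_e/e := {x : xe = ex ∈ H_e}`. -/
def HeCoideal (e : X) : Set X := {x | x * e = e * x ∧ x * e ∈ maxSubgroup X e}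

/-- `I` is an ideal of the semigroup `X`. -/
def IsIdealSet (I : Set X) : Prop := ∀ x ∈ I, ∀ y : X, x * y ∈ I ∧ y * x ∈ I

/-- The set `VE(X)` of viable idempotents: `e` is idempotent and `X ∖ (H_e/e)` is an ideal. -/
def viableIdems : Set X := {e | e ∈ idemSet X ∧ IsIdealSet X (Set.univ \ HeCoideal X e)}

/-- The center `Z(X)`. -/
def centerSet : Set X := {z | ∀ x, z * x = x * z}

/-- `√A = {x : xⁿ ∈ A for some n ≥ 1}`. -/
def sqrtSet (A : Set X) : Set X := {x | ∃ n : ℕ, spow x n ∈ A}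

/-- A subset `B ⊆ X` is bounded: there is `n ≥ 1` with `xⁿ` idempotent for all `x ∈ B`. -/
def BoundedSet (B : Set X) : Prop := ∃ n : ℕ, ∀ x ∈ B, spow x n ∈ idemSet X

/-- The semigroup `X` is bounded. -/
def BoundedSemigroup : Prop := ∃ n : ℕ, ∀ x : X, spow x n ∈ idemSet X

/-- `X` is chain-finite. -/
def ChainFinite : Prop :=
  ∀ I : Set X, I.Infinite → ∃ x ∈ I, ∃ y ∈ I, x * y ≠ x ∧ x * y ≠ y

/-- `G ⊆ X` is a subgroup of the semigroup `X`. -/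
def IsSubgroupSet (G : Set X) : Prop :=
  (∀ x ∈ G, ∀ y ∈ G, x * y ∈ G) ∧
    ∃ e ∈ G, (∀ x ∈ G, x * e = x ∧ e * x = x) ∧ ∀ x ∈ G, ∃ y ∈ G, x * y = e ∧ y * x = e

/-- `X` is group-finite: all its subgroups are finite. -/
def GroupFinite : Prop := ∀ G : Set X, IsSubgroupSet X G → G.Finite

/-- `X` is Clifford+finite: `X ∖ H(X)` is finite. -/
def CliffordPlusFinite : Prop := (Set.univ \ cliffordPart X).Finite

/-- `X` is `E`-commutative: idempotents commute. -/
def ECommutative : Prop := ∀ x ∈ idemSet X, ∀ y ∈ idemSet X, x * y = y * x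

end AlgDefs

/-- The Rees congruence associated with an ideal `I` of `X`. -/
def ReesCon {X : Type*} [Semigroup X] (I : Set X) (hI : IsIdealSet X I) : Con X where
  r x y := x = y ∨ (x ∈ I ∧ y ∈ I)
  iseqv :=
    { refl := fun _ => Or.inl rfl
      symm := by rintro x y (rfl | ⟨h1, h2⟩); exacts [Or.inl rfl, Or.inr ⟨h2, h1⟩]
      trans := by
        rintro x y z (rfl | ⟨h1, h2⟩) (rfl | ⟨h3, h4⟩)
        exacts [Or.inl rfl, Or.inr ⟨h3, h4⟩, Or.inr ⟨h1, h2⟩, Or.inr ⟨h1, h4⟩] }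
  mul' := by
    rintro a b c d (rfl | ⟨h1, h2⟩) (rfl | ⟨h3, h4⟩)
    · exact Or.inl rfl
    · exact Or.inr ⟨(hI c h3 a).2, (hI d h4 a).2⟩
    · exact Or.inr ⟨(hI a h1 c).1, (hI b h2 c).1⟩
    · exact Or.inr ⟨(hI a h1 c).1, (hI b h2 d).1⟩

/-- `X` is ideally `T₂S`-closed: all its Rees quotients are `T₂S`-closed. -/
def IdeallyT2SClosed (X : Type u) [Semigroup X] : Prop :=
  ∀ (I : Set X) (hI : IsIdealSet X I), T2SClosed (ReesCon I hI).Quotient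

/-- `X` is ideally `TzS`-closed. -/
def IdeallyTzSClosed (X : Type u) [Semigroup X] : Prop :=
  ∀ (I : Set X) (hI : IsIdealSet X I), TzSClosed (ReesCon I hI).Quotient

/-- A congruence is a semilattice congruence if its quotient is a commutative
semigroup of idempotents. -/
def IsSemilatticeCon {X : Type*} [Semigroup X] (c : Con X) : Prop :=
  (∀ a b : c.Quotient, a * b = b * a) ∧ ∀ a : c.Quotient, a * a = a

/-- The smallest semilattice congruence `⇕` on `X`, the intersection of all
semilattice congruences. -/
def slCon (X : Type*) [Semigroup X] : Con X := sInf {c | IsSemilatticeCon c}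

theorem centerSet_mul_mem {X : Type*} [Semigroup X] {a b : X}
    (ha : a ∈ centerSet X) (hb : b ∈ centerSet X) : a * b ∈ centerSet X := fun t => by
  rw [mul_assoc, hb t, ← mul_assoc, ha t, mul_assoc]

/-- The ideal center `IZ(X) = {z ∈ Z(X) : zX ⊆ Z(X)}`, as a subsemigroup of `X`. -/
def idealCenter (X : Type*) [Semigroup X] : Subsemigroup X where
  carrier := {z | z ∈ centerSet X ∧ ∀ x : X, z * x ∈ centerSet X}
  mul_mem' := by
    rintro a b ⟨ha, ha'⟩ ⟨hb, hb'⟩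
    refine ⟨centerSet_mul_mem ha hb, fun x => ?_⟩
    have h : a * b * x = a * (b * x) := mul_assoc a b x
    rw [h]
    exact centerSet_mul_mem ha (hb' x)

/-- Evaluation of the semigroup polynomial with coefficients `a, l = [a₁, …, aₙ]`:
`x ↦ a * x * a₁ * x * ⋯ * x * aₙ` (computed in `X¹ = WithOne X`). -/
def polyEval {X : Type*} [Semigroup X] (a : WithOne X) (l : List (WithOne X)) (x : X) :
    WithOne X :=
  l.foldl (fun acc b => acc * (x : WithOne X) * b) a

/-- `f : X → X¹` is a semigroup polynomial of degree `d ≥ 1`. -/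
def IsSemigroupPolynomial {X : Type*} [Semigroup X] (f : X → WithOne X) (d : ℕ) : Prop :=
  1 ≤ d ∧ ∃ (a : WithOne X) (l : List (WithOne X)), l.length = d ∧ ∀ x, f x = polyEval a l x

/-- `X` is polybounded. -/
def Polybounded (X : Type*) [Semigroup X] : Prop :=
  ∃ (k : ℕ) (f : Fin k → X → WithOne X) (d : Fin k → ℕ) (b : Fin k → X),
    (∀ i, IsSemigroupPolynomial (f i) (d i)) ∧ ∀ x : X, ∃ i, f i x = (b i : WithOne X)

/-- `X` is polyfinite. -/
def Polyfinite (X : Type*) [Semigroup X] : Prop :=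
  ∃ (d : ℕ) (F : Set X), F.Finite ∧ ∀ x y : X,
    ∃ (f : X → WithOne X) (m : ℕ), m ≤ d ∧ IsSemigroupPolynomial f m ∧
      (∃ u ∈ F, f x = (u : WithOne X)) ∧ ∃ v ∈ F, f y = (v : WithOne X)

/-- `X` is `B`-centrobounded over `B ⊆ E(X)`: there is `n ≥ 1` such that for every
`e ∈ B` and all `x, y ∈ ⋂_{a ∈ B} H_a/a`, if `w` is the inverse of `y*e` in the group
`H_e` and `(x*e)*w ∈ H_e ∩ Z(X)`, then `((x*e)*w)ⁿ` is an idempotent. -/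
def Centrobounded {X : Type*} [Semigroup X] (B : Set X) : Prop :=
  ∃ n : ℕ, ∀ e ∈ B, ∀ x ∈ ⋂ a ∈ B, HeCoideal X a, ∀ y ∈ ⋂ a ∈ B, HeCoideal X a,
    ∀ w ∈ maxSubgroup X e, (y * e) * w = e → w * (y * e) = e →
      (x * e) * w ∈ maxSubgroup X e → (x * e) * w ∈ centerSet X →
        spow ((x * e) * w) n ∈ idemSet X

/-- `B` is an antichain in the natural partial order `e ≤ f ⇔ ef = fe = e` on idempotents. -/
def IsIdemAntichain {X : Type*} [Semigroup X] (B : Set X) : Prop :=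
  ∀ e ∈ B, ∀ f ∈ B, e ≠ f → ¬(e * f = e ∧ f * e = e) ∧ ¬(e * f = f ∧ f * e = f)

open Filter Topology in
theorem mul_nhds_idem {Y : Type*} [Semigroup Y] [TopologicalSpace Y] [ContinuousMul Y]
    {z : Y} (hz : z * z = z) {U : Set Y} (hU : U ∈ 𝓝 z) :
    ∃ V ∈ 𝓝 z, V ⊆ U ∧ ∀ a ∈ V, ∀ b ∈ V, a * b ∈ U := by
  have h : Tendsto (fun p : Y × Y => p.1 * p.2) (𝓝 z ×ˢ 𝓝 z) (𝓝 z) := by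
    have := (continuous_mul (M := Y)).tendsto (z, z)
    simpa [nhds_prod_eq, hz] using this
  obtain ⟨V, hV, hVU⟩ := mem_prod_same_iff.1 (h hU)
  exact ⟨V ∩ U, inter_mem hV hU, inter_subset_right,
    fun a ha b hb => hVU (mk_mem_prod ha.1 hb.1)⟩

/-- A sequence of neighbourhoods of `z`, each of which contains the next one and its square. -/
structure NhdsSeq {Y : Type*} [Semigroup Y] [TopologicalSpace Y] (z : Y) where
  /-- the neighbourhoods -/
  V : ℕ → Set Y
  mem : ∀ n, V n ∈ nhds z
  sub : ∀ n, V (n + 1) ⊆ V n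
  mul : ∀ n, ∀ a ∈ V (n + 1), ∀ b ∈ V (n + 1), a * b ∈ V n

namespace NhdsSeq

variable {Y : Type*} [Semigroup Y] [TopologicalSpace Y] {z : Y}

theorem exists_subset [ContinuousMul Y] (hz : z * z = z) (W : ℕ → Set Y)
    (hW : ∀ n, W n ∈ nhds z) : ∃ S : NhdsSeq z, ∀ n, S.V n ⊆ W n := by
  choose! f hf hfs hfm using fun U (hU : U ∈ nhds z) => mul_nhds_idem hz hU
  let V : ℕ → Set Y := fun n => Nat.rec (W 0) (fun n A => f A ∩ W (n + 1)) n
  have hV : ∀ n, V n ∈ nhds z := by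
    intro n
    induction n with
    | zero => exact hW 0
    | succ n ih => exact Filter.inter_mem (hf _ ih) (hW _)
  refine ⟨⟨V, hV, fun n => inter_subset_left.trans (hfs _ (hV n)),
    fun n a ha b hb => hfm _ (hV n) a ha.1 b hb.1⟩, fun n => ?_⟩
  cases n with
  | zero => exact subset_rfl
  | succ n => exact inter_subset_right

variable {E : Type*} [SemilatticeInf E] {h : E → Y}

/-- The elements whose image lies in all neighbourhoods of the sequence. -/
def core (h : E → Y) (S : NhdsSeq z) : Set E := {e | ∀ n, h e ∈ S.V n}

theorem inf_mem_core (hh : ∀ a b, h (a ⊓ b) = h a * h b) (S : NhdsSeq z) {a b : E}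
    (ha : a ∈ S.core h) (hb : b ∈ S.core h) : a ⊓ b ∈ S.core h := fun n => by
  rw [hh]
  exact S.mul n _ (ha _) _ (hb _)

theorem antitone (S : NhdsSeq z) : Antitone S.V := antitone_nat_of_succ_le S.sub

theorem exists_core_le [WellFoundedLT E] [WellFoundedGT E]
    (hh : ∀ a b, h (a ⊓ b) = h a * h b) (S : NhdsSeq z) {W : Filter E} [W.NeBot]
    (hW : Filter.Tendsto h W (nhds z)) {A : Set E} (hA : A ∈ W) :
    ∃ g ∈ S.core h, ∃ x ∈ A, g ≤ x := by
  have hne : ∀ k, ∃ x ∈ A, h x ∈ S.V k := fun k => by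
    obtain ⟨x, hx⟩ := Filter.nonempty_of_mem (Filter.inter_mem hA (hW (S.mem k)))
    exact ⟨x, hx.1, hx.2⟩
  choose x hxA hxV using hne
  let P : ℕ → ℕ → E := fun m r => Nat.rec (motive := fun _ => ℕ → E) (fun m => x m)
    (fun _ Q m => x m ⊓ Q (m + 1)) r m
  have P0 : ∀ m, P m 0 = x m := fun m => rfl
  have PS : ∀ m r, P m (r + 1) = x m ⊓ P (m + 1) r := fun m r => rfl
  have hPV : ∀ r m, h (P (m + 1) r) ∈ S.V m := by
    intro r
    induction r with
    | zero => exact fun m => S.sub m (hxV _)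
    | succ r ih => exact fun m => by rw [PS, hh]; exact S.mul m _ (hxV _) _ (ih _)
  have hPa : ∀ r m, P m (r + 1) ≤ P m r := by
    intro r
    induction r with
    | zero => exact fun m => inf_le_left
    | succ r ih => exact fun m => inf_le_inf_left _ (ih _)
  have hstab : ∀ m, ∃ R, ∀ r, R ≤ r → P m R = P m r := fun m => by
    obtain ⟨n, hn⟩ := WellFoundedGT.monotone_chain_condition (α := Eᵒᵈ)
      ⟨fun r => OrderDual.toDual (P m r), monotone_nat_of_le_succ fun r => hPa r m⟩
    exact ⟨n, fun r hr => hn r hr⟩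
  choose R hR using hstab
  let g : ℕ → E := fun m => P m (R m)
  have hgx : ∀ m, g m = x m ⊓ g (m + 1) := fun m => by
    have h1 : g m = P m (max (R m) (R (m + 1)) + 1) :=
      hR m (max (R m) (R (m + 1)) + 1) (by omega)
    have h2 : g (m + 1) = P (m + 1) (max (R m) (R (m + 1))) :=
      hR (m + 1) (max (R m) (R (m + 1))) (by omega)
    rw [h1, h2, PS]
  obtain ⟨n, hn⟩ := WellFoundedGT.monotone_chain_condition (α := E)
    ⟨g, monotone_nat_of_le_succ fun m => by rw [hgx m]; exact inf_le_right⟩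
  refine ⟨g n, fun k => ?_, x n, hxA n, by rw [hgx n]; exact inf_le_left⟩
  have h1 : g n = g (n + k + 1) := hn _ (by omega)
  have h2 : h (g (n + k + 1)) ∈ S.V (n + k) := hPV _ _
  rw [h1]
  exact S.antitone (by omega) h2

end NhdsSeq

/-- An idempotent limit of the images of a filter on a semilattice without infinite chains is
itself an image, of an element lying frequently below the elements of the filter. -/
theorem exists_eq_frequently_le {E Y : Type*} [SemilatticeInf E] [WellFoundedLT E]
    [WellFoundedGT E] [Semigroup Y] [TopologicalSpace Y] [ContinuousMul Y] [T1Space Y]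
    {h : E → Y} (hh : ∀ a b, h (a ⊓ b) = h a * h b) {z : Y} (hz : z * z = z)
    {W : Filter E} [W.NeBot] (hW : Filter.Tendsto h W (nhds z)) :
    ∃ e, h e = z ∧ ∃ᶠ x in W, e ≤ x := by
  have hleast : ∀ S : NhdsSeq z, ∃ y ∈ S.core h, ∀ g ∈ S.core h, y ≤ g := fun S => by
    obtain ⟨g, hg, -⟩ := S.exists_core_le hh hW Filter.univ_mem
    obtain ⟨y, hy, hmin⟩ := wellFounded_lt.has_min (S.core h) ⟨g, hg⟩
    refine ⟨y, hy, fun g hg => ?_⟩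
    by_contra hlt
    exact hmin _ (S.inf_mem_core hh hy hg) (inf_lt_left.2 hlt)
  choose y hy hyle using hleast
  obtain ⟨S₀, -⟩ := NhdsSeq.exists_subset hz (fun _ => univ) (fun _ => Filter.univ_mem)
  obtain ⟨-, ⟨S, rfl⟩, hmax⟩ := wellFounded_gt.has_min (range y) ⟨_, mem_range_self S₀⟩
  refine ⟨y S, ?_, fun hev => ?_⟩
  · by_contra hne
    have hU : {h (y S)}ᶜ ∈ nhds z := isOpen_compl_singleton.mem_nhds (Ne.symm hne)
    obtain ⟨T, hT⟩ := NhdsSeq.exists_subset hz (fun n => S.V n ∩ {h (y S)}ᶜ)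
      (fun n => Filter.inter_mem (S.mem n) hU)
    have hle : y S ≤ y T := hyle S _ fun n => (hT n (hy T n)).1
    have heq : y S = y T := by
      by_contra hne'
      exact hmax _ (mem_range_self T) (lt_of_le_of_ne hle hne')
    have := (hT 0 (hy T 0)).2
    rw [← heq] at this
    exact this rfl
  · obtain ⟨g, hg, x, hxA, hgx⟩ := S.exists_core_le hh hW hev
    exact hxA ((hyle S g hg).trans hgx)

section Spow

theorem map_spow {X Y : Type*} [Semigroup X] [Semigroup Y] (h : X →ₙ* Y) (x : X) (n : ℕ) :
    h (spow x n) = spow (h x) n := by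
  induction n with
  | zero => rfl
  | succ n ih => simp only [spow, map_mul, ih]

theorem spow_eq_pow {M : Type*} [Monoid M] (x : M) (n : ℕ) : spow x n = x ^ (n + 1) := by
  induction n with
  | zero => simp [spow]
  | succ n ih => rw [spow, ih, pow_succ x (n + 1)]

theorem mul_spow {X : Type*} [CommSemigroup X] (x y : X) (n : ℕ) :
    spow (x * y) n = spow x n * spow y n := by
  induction n with
  | zero => rfl
  | succ n ih => simp only [spow, ih, mul_mul_mul_comm]

theorem spow_of_idem {X : Type*} [Semigroup X] {e : X} (he : e * e = e) (n : ℕ) :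
    spow e n = e := by
  induction n with
  | zero => rfl
  | succ n ih => rw [spow, ih, he]

theorem continuous_spow {Y : Type*} [Semigroup Y] [TopologicalSpace Y] [ContinuousMul Y]
    (n : ℕ) : Continuous fun y : Y => spow y n := by
  induction n with
  | zero => exact continuous_id
  | succ n ih => exact ih.mul continuous_id

end Spow

/-- The semilattice of idempotents of a commutative semigroup. -/
def Idem (X : Type*) [CommSemigroup X] : Type _ := {x : X // x * x = x}

instance (X : Type*) [CommSemigroup X] : SemilatticeInf (Idem X) where
  le a b := a.1 * b.1 = a.1
  le_refl a := a.2
  le_trans a b c hab hbc := by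
    have hab : a.1 * b.1 = a.1 := hab
    have hbc : b.1 * c.1 = b.1 := hbc
    rw [← hab, mul_assoc, hbc]
  le_antisymm a b hab hba := Subtype.ext <| by
    have hab : a.1 * b.1 = a.1 := hab
    have hba : b.1 * a.1 = b.1 := hba
    rw [← hab, mul_comm, hba]
  inf a b := ⟨a.1 * b.1, by rw [mul_mul_mul_comm, a.2, b.2]⟩
  inf_le_left a b := by
    change a.1 * b.1 * a.1 = a.1 * b.1
    rw [mul_right_comm, a.2]
  inf_le_right a b := by
    change a.1 * b.1 * b.1 = a.1 * b.1
    rw [mul_assoc, b.2]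
  le_inf a b c hab hac := by
    have hab : a.1 * b.1 = a.1 := hab
    have hac : a.1 * c.1 = a.1 := hac
    change a.1 * (b.1 * c.1) = a.1
    rw [← mul_assoc, hab, hac]

theorem Idem.le_iff {X : Type*} [CommSemigroup X] {a b : Idem X} : a ≤ b ↔ a.1 * b.1 = a.1 :=
  Iff.rfl

theorem Idem.coe_inf {X : Type*} [CommSemigroup X] (a b : Idem X) : (a ⊓ b).1 = a.1 * b.1 :=
  rfl

/-- The finiteness conditions characterising absolutely `T₂S`-closed commutative semigroups. -/
structure IsTame (X : Type*) [CommSemigroup X] : Prop where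
  lt : WellFoundedLT (Idem X)
  gt : WellFoundedGT (Idem X)
  bounded : ∃ n : ℕ, (∀ x : X, spow x n * spow x n = spow x n) ∧
    {x : X | spow x n * x ≠ x}.Finite ∧
    ∀ e : X, e * e = e → {u : X | u * e = u ∧ spow u n = e}.Finite

theorem IsTame.of_injective {X Z : Type*} [CommSemigroup X] [CommSemigroup Z]
    (hX : IsTame X) (f : Z →ₙ* X) (hf : Function.Injective f) : IsTame Z := by
  have hlt := hX.lt
  have hgt := hX.gt
  let F : Idem Z → Idem X := fun e => ⟨f e.1, by rw [← map_mul, e.2]⟩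
  have hF : StrictMono F := by
    refine Monotone.strictMono_of_injective (fun a b hab => ?_) fun a b hab => ?_
    · rw [Idem.le_iff] at hab ⊢
      change f a.1 * f b.1 = f a.1
      rw [← map_mul, hab]
    · exact Subtype.ext (hf (congrArg Subtype.val hab))
  refine ⟨hF.wellFoundedLT, hF.wellFoundedGT, ?_⟩
  obtain ⟨n, h1, h2, h3⟩ := hX.bounded
  refine ⟨n, fun x => hf ?_, ?_, fun e he => ?_⟩
  · rw [map_mul, map_spow, h1]
  · refine (h2.preimage hf.injOn).subset fun x hx => ?_
    change spow (f x) n * f x ≠ f x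
    rw [← map_spow, ← map_mul]
    exact fun h => hx (hf h)
  · refine ((h3 (f e) (by rw [← map_mul, he])).preimage hf.injOn).subset fun x hx => ?_
    change f x * f e = f x ∧ spow (f x) n = f e
    rw [← map_mul, ← map_spow, hx.1, hx.2]
    exact ⟨rfl, rfl⟩

open Filter Topology in
theorem IsTame.absolutelyT2SClosed {X : Type u} [CommSemigroup X] (hX : IsTame X) :
    AbsolutelyT2SClosed X := by
  intro Y _ _ _ _ h
  have := hX.lt
  have := hX.gt
  obtain ⟨n, hidem, hfin, hgrp⟩ := hX.bounded
  refine isClosed_of_closure_subset fun y hy => ?_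
  rw [← image_univ, ← union_compl_self {x : X | spow x n * x ≠ x}, image_union,
    closure_union] at hy
  rcases hy with hy | hy
  · rw [(hfin.image h).isClosed.closure_eq] at hy
    exact image_subset_range _ _ hy
  let F : Filter X := comap h (𝓝 y) ⊓ 𝓟 {x : X | spow x n * x ≠ x}ᶜ
  have hF : F.NeBot := by
    refine NeBot.of_map (m := h) ?_
    rw [Filter.push_pull', map_principal]
    exact mem_closure_iff_clusterPt.1 hy
  have hFy : Tendsto h F (𝓝 y) := tendsto_comap.mono_left inf_le_left
  have hFp : Tendsto (fun x => h (spow x n)) F (𝓝 (spow y n)) := by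
    simp only [map_spow]
    exact ((continuous_spow n).tendsto y).comp hFy
  have hzz : spow y n * spow y n = spow y n := by
    refine tendsto_nhds_unique (hFp.mul hFp) (hFp.congr fun x => ?_)
    rw [← map_mul, hidem]
  have hzy : spow y n * y = y := by
    refine tendsto_nhds_unique (hFp.mul hFy) (hFy.congr' ?_)
    filter_upwards [mem_inf_of_right (mem_principal_self _)] with x hx
    rw [← map_mul, not_not.1 hx]
  let π : X → Idem X := fun x => ⟨spow x n, hidem x⟩
  obtain ⟨e, he, hfr⟩ := exists_eq_frequently_le (E := Idem X) (h := fun e => h e.1)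
    (W := map π F) (fun a b => map_mul h a.1 b.1) hzz (tendsto_map'_iff.2 hFp)
  have hlim : Tendsto (fun x => h (e.1 * x)) F (𝓝 y) := by
    simp only [map_mul, he]
    have := (tendsto_const_nhds (x := spow y n) (f := F)).mul hFy
    rwa [hzy] at this
  have hmem := ((hgrp e.1 e.2).image h).isClosed.mem_of_frequently_of_tendsto
    (b := F) (f := fun x => h (e.1 * x)) ?_ hlim
  · exact image_subset_range _ _ hmem
  · refine (frequently_map.1 hfr).mono fun x hx => mem_image_of_mem h ⟨?_, ?_⟩
    · rw [mul_right_comm, e.2]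
    · rw [mul_spow, spow_of_idem e.2]
      exact Idem.le_iff.1 hx

section Transfer

theorem AbsolutelyT2SClosed.of_surjective {X Z : Type u} [Semigroup X] [Semigroup Z]
    (hX : AbsolutelyT2SClosed X) (f : X →ₙ* Z) (hf : Function.Surjective f) :
    AbsolutelyT2SClosed Z := by
  intro Y _ _ _ _ h
  have := hX Y (h.comp f)
  rwa [MulHom.coe_comp, hf.range_comp] at this

theorem AbsolutelyT1SClosed.absolutelyT2SClosed {X : Type u} [Semigroup X]
    (hX : AbsolutelyT1SClosed X) : AbsolutelyT2SClosed X :=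
  fun Y _ _ _ _ h => hX Y h

theorem range_withOne {X Y : Type*} (h : WithOne X → Y) :
    range h = range (fun x : X => h x) ∪ {h 1} := by
  ext y
  constructor
  · rintro ⟨x, rfl⟩
    exact WithOne.cases_on x (Or.inr rfl) fun x => Or.inl ⟨x, rfl⟩
  · rintro (⟨x, rfl⟩ | rfl)
    exacts [mem_range_self _, mem_range_self _]

theorem AbsolutelyT2SClosed.withOne {X : Type u} [Semigroup X]
    (hX : AbsolutelyT2SClosed X) : AbsolutelyT2SClosed (WithOne X) := by
  intro Y _ _ _ _ h
  rw [range_withOne]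
  exact (hX Y (h.comp WithOne.coeMulHom)).union isClosed_singleton

theorem AbsolutelyT1SClosed.withOne {X : Type u} [Semigroup X]
    (hX : AbsolutelyT1SClosed X) : AbsolutelyT1SClosed (WithOne X) := by
  intro Y _ _ _ _ h
  rw [range_withOne]
  exact (hX Y (h.comp WithOne.coeMulHom)).union isClosed_singleton

end Transfer

section FilterExtension

open Filter Topology
open scoped Pointwise

theorem continuous_filter_mul {Q : Type*} [Mul Q] :
    Continuous fun p : Filter Q × Filter Q => p.1 * p.2 := by
  refine continuous_generateFrom_iff.2 ?_
  rintro _ ⟨s, rfl⟩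
  rw [isOpen_iff_mem_nhds]
  rintro ⟨f, g⟩ hfg
  obtain ⟨t₁, h₁, t₂, h₂, h⟩ := Filter.mem_mul.1 (le_principal_iff.1 hfg)
  have ho : ∀ t : Set Q, IsOpen {l : Filter Q | t ∈ l} := fun t => by
    simpa [Iic, le_principal_iff] using isOpen_Iic_principal (s := t)
  refine mem_of_superset (prod_mem_nhds ((ho t₁).mem_nhds h₁) ((ho t₂).mem_nhds h₂)) ?_
  rintro ⟨f', g'⟩ ⟨h₁', h₂'⟩
  exact le_principal_iff.2 (mem_of_superset (Filter.mul_mem_mul h₁' h₂') h)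

/-- A filter on an absolutely `T₂S`-closed monoid is principal as soon as together with the
points it generates a Hausdorff semigroup of filters. -/
theorem AbsolutelyT2SClosed.exists_eq_pure {Q : Type u} [CommMonoid Q]
    (hQ : AbsolutelyT2SClosed Q) {F : Filter Q} [F.NeBot]
    (hF : ∃ q : Q, F * F = pure q ∨ F * F = pure q * F)
    (hd : ∀ a b : Q, pure a * F = pure b * F ∨ Disjoint (pure a * F) (pure b * F))
    (hp : ∀ a b : Q, pure a * F = pure b ∨ Disjoint (pure a * F) (pure b)) :
    ∃ q : Q, F = pure q := by
  obtain ⟨q, hq⟩ := hF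
  let Y : Subsemigroup (Filter Q) :=
    { carrier := {G | (∃ a : Q, G = pure a) ∨ ∃ a : Q, G = pure a * F}
      mul_mem' := by
        rintro _ _ (⟨a, rfl⟩ | ⟨a, rfl⟩) (⟨b, rfl⟩ | ⟨b, rfl⟩)
        · exact Or.inl ⟨a * b, Filter.pure_mul_pure⟩
        · exact Or.inr ⟨a * b, by rw [← mul_assoc, Filter.pure_mul_pure]⟩
        · exact Or.inr ⟨a * b, by rw [mul_right_comm, Filter.pure_mul_pure]⟩
        · rw [mul_mul_mul_comm, Filter.pure_mul_pure]
          rcases hq with hq | hq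
          · exact Or.inl ⟨a * b * q, by rw [hq, Filter.pure_mul_pure]⟩
          · exact Or.inr ⟨a * b * q, by rw [hq, ← mul_assoc, Filter.pure_mul_pure]⟩ }
  have hmem : ∀ G, G ∈ Y ↔ (∃ a : Q, G = pure a) ∨ ∃ a : Q, G = pure a * F := fun G => Iff.rfl
  have hne : ∀ G ∈ Y, G.NeBot := by
    rintro _ (⟨a, rfl⟩ | ⟨a, rfl⟩)
    · infer_instance
    · exact Filter.NeBot.mul inferInstance inferInstance
  have hdis : ∀ G ∈ Y, ∀ G' ∈ Y, G ≠ G' → Disjoint G G' := by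
    rintro _ (⟨a, rfl⟩ | ⟨a, rfl⟩) _ (⟨b, rfl⟩ | ⟨b, rfl⟩) h
    · exact disjoint_pure_pure.2 fun hab => h (hab ▸ rfl)
    · exact ((hp b a).resolve_left h.symm).symm
    · exact (hp a b).resolve_left h
    · exact (hd a b).resolve_left h
  have : ContinuousMul Y :=
    ⟨Continuous.subtype_mk (continuous_filter_mul.comp
      (continuous_subtype_val.prodMap continuous_subtype_val)) _⟩
  have ho : ∀ t : Set Q, IsOpen {l : Filter Q | t ∈ l} := fun t => by
    simpa [Iic, le_principal_iff] using isOpen_Iic_principal (s := t)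
  have : T2Space Y := by
    refine ⟨fun G G' h => ?_⟩
    obtain ⟨s, hs, t, ht, hst⟩ := Filter.disjoint_iff.1
      (hdis G.1 G.2 G'.1 G'.2 fun h' => h (Subtype.ext h'))
    refine ⟨_, _, (ho s).preimage continuous_subtype_val, (ho t).preimage continuous_subtype_val,
      hs, ht, disjoint_left.2 fun P hP hP' => ?_⟩
    have := hne P.1 P.2
    have h0 := Filter.inter_mem hP hP'
    rw [hst.inter_eq] at h0
    exact empty_notMem _ h0
  let h : Q →ₙ* Y :=
    { toFun := fun a => ⟨pure a, Or.inl ⟨a, rfl⟩⟩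
      map_mul' := fun a b => Subtype.ext (Filter.pure_mul_pure).symm }
  have hFY : F ∈ Y := Or.inr ⟨1, by rw [Filter.pure_one, one_mul]⟩
  have hcl : (⟨F, hFY⟩ : Y) ∈ closure (range h) := by
    rw [closure_subtype, Filter.mem_closure]
    intro s hs
    obtain ⟨a, ha⟩ := Filter.nonempty_of_mem hs
    exact ⟨pure a, ⟨h a, mem_range_self a, rfl⟩, ha⟩
  rw [(hQ Y h).closure_eq] at hcl
  obtain ⟨a, ha⟩ := hcl
  exact ⟨a, (congrArg Subtype.val ha).symm⟩

/-- For ultrafilters the separation conditions are automatic. -/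
theorem AbsolutelyT2SClosed.exists_eq_pure_ultrafilter {Q : Type u} [CommMonoid Q]
    (hQ : AbsolutelyT2SClosed Q) (U : Ultrafilter Q)
    (hU : ∃ q : Q, (U : Filter Q) * U = pure q ∨ (U : Filter Q) * U = pure q * U) :
    ∃ q : Q, (U : Filter Q) = pure q := by
  have hmap : ∀ a : Q, pure a * (U : Filter Q) = (U.map (a * ·) : Ultrafilter Q) := fun a => by
    rw [Filter.pure_mul, Ultrafilter.coe_map]
  have hdis : ∀ V W : Ultrafilter Q, (V : Filter Q) = W ∨ Disjoint (V : Filter Q) W :=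
    fun V W => by
      by_cases h : V = W
      · exact Or.inl (h ▸ rfl)
      · exact Or.inr (Ultrafilter.disjoint_iff_not_le.2
          fun hle => h (Ultrafilter.coe_le_coe.1 hle))
  refine hQ.exists_eq_pure hU (fun a b => ?_) fun a b => ?_
  · rw [hmap, hmap]
    exact hdis _ _
  · rw [hmap]
    exact hdis _ (pure b)

/-- There is no infinite set of idempotents all of whose products are one of the factors. -/
theorem AbsolutelyT2SClosed.not_infinite_chain {Q : Type u} [CommMonoid Q]
    (hQ : AbsolutelyT2SClosed Q) (s : ℕ → Q) (hs : Function.Injective s)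
    (hmul : ∀ i j, s i * s j = s i ∨ s i * s j = s j) : False := by
  let U : Ultrafilter Q := (hyperfilter ℕ).map s
  have hmem : ∀ t, t ∈ (U : Filter Q) ↔ s ⁻¹' t ∈ (hyperfilter ℕ : Filter ℕ) := fun t => Iff.rfl
  have hidem : (U : Filter Q) * U = U := by
    refine le_antisymm (fun t ht => ?_) fun t ht => ?_
    · refine Filter.mem_mul.2 ⟨t ∩ range s, ?_, t ∩ range s, ?_, ?_⟩
      · exact Filter.inter_mem ht (range_mem_map)
      · exact Filter.inter_mem ht (range_mem_map)
      · rintro _ ⟨_, ⟨ha, i, rfl⟩, _, ⟨hb, j, rfl⟩, rfl⟩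
        rcases hmul i j with h | h <;> simpa only [h]
    · obtain ⟨t₁, h₁, t₂, h₂, h⟩ := Filter.mem_mul.1 ht
      rw [hmem]
      filter_upwards [(hmem _).1 h₁, (hmem _).1 h₂] with i hi₁ hi₂
      have : s i * s i = s i := (hmul i i).elim id id
      exact h ⟨s i, hi₁, s i, hi₂, this⟩
  obtain ⟨q, hq⟩ := hQ.exists_eq_pure_ultrafilter U
    ⟨1, Or.inr (by rw [hidem, Filter.pure_one, one_mul])⟩
  have h1 : {q} ∈ (U : Filter Q) := by rw [hq]; exact mem_pure.2 rfl
  have h2 : (s ⁻¹' {q}).Finite := (finite_singleton q).preimage hs.injOn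
  exact notMem_hyperfilter_of_finite h2 h1

end FilterExtension

theorem AbsolutelyT2SClosed.wellFoundedLT {Q : Type u} [CommMonoid Q]
    (hQ : AbsolutelyT2SClosed Q) : WellFoundedLT (Idem Q) := by
  refine ⟨RelEmbedding.wellFounded_iff_isEmpty.2 ⟨fun f => ?_⟩⟩
  have hmono : ∀ i j, i < j → f j ≤ f i := fun i j h => (f.map_rel_iff.2 h).le
  refine hQ.not_infinite_chain (fun i => (f i).1) (Subtype.val_injective.comp f.injective)
    fun i j => ?_
  rcases lt_trichotomy i j with h | rfl | h
  · exact Or.inr ((mul_comm _ _).trans (Idem.le_iff.1 (hmono i j h)))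
  · exact Or.inl (f i).2
  · exact Or.inl (Idem.le_iff.1 (hmono j i h))

theorem AbsolutelyT2SClosed.wellFoundedGT {Q : Type u} [CommMonoid Q]
    (hQ : AbsolutelyT2SClosed Q) : WellFoundedGT (Idem Q) := by
  refine ⟨RelEmbedding.wellFounded_iff_isEmpty.2 ⟨fun f => ?_⟩⟩
  have hmono : ∀ i j, i < j → f i ≤ f j := fun i j h => (f.map_rel_iff.2 h).le
  refine hQ.not_infinite_chain (fun i => (f i).1) (Subtype.val_injective.comp f.injective)
    fun i j => ?_
  rcases lt_trichotomy i j with h | rfl | h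
  · exact Or.inl (Idem.le_iff.1 (hmono i j h))
  · exact Or.inl (f i).2
  · exact Or.inr ((mul_comm _ _).trans (Idem.le_iff.1 (hmono j i h)))

/-- Any sequence of pairwise distinct idempotents has an infinite antichain. -/
theorem AbsolutelyT2SClosed.exists_antichain {Q : Type u} [CommMonoid Q]
    (hQ : AbsolutelyT2SClosed Q) (f : ℕ → Idem Q) (hf : Function.Injective f) :
    ∃ g : ℕ ↪o ℕ, ∀ m n, m ≠ n → ¬ f (g m) ≤ f (g n) := by
  have := hQ.wellFoundedLT
  have := hQ.wellFoundedGT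
  obtain ⟨g, hg | hg⟩ := exists_increasing_or_nonincreasing_subseq (· < ·) f
  · exact (WellFounded.not_rel_apply_succ (r := (· > ·))
      fun n => f (g n)).elim fun n hn => (hn (hg n (n + 1) n.lt_succ_self)).elim
  obtain ⟨g', hg' | hg'⟩ := exists_increasing_or_nonincreasing_subseq (· > ·) (f ∘ g)
  · exact (WellFounded.not_rel_apply_succ (r := (· < ·))
      fun n => f (g (g' n))).elim fun n hn => (hn (hg' n (n + 1) n.lt_succ_self)).elim
  refine ⟨g'.trans g, fun m n hmn hle => ?_⟩
  have hlt : f (g (g' m)) < f (g (g' n)) := lt_of_le_of_ne hle fun h =>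
    hmn (g'.injective (g.injective (hf h)))
  rcases hmn.lt_or_gt with h | h
  · exact hg _ _ (g'.lt_iff_lt.2 h) hlt
  · exact hg' _ _ h hlt

section Periodic

open Filter Topology
open scoped Pointwise

theorem AbsolutelyT2SClosed.not_injective_pow {Q : Type u} [CommMonoid Q]
    (hQ : AbsolutelyT2SClosed Q) (x : Q) (hx : Function.Injective fun k : ℕ => x ^ k)
    (h : ∀ a : Q, a * x = a ∨ Function.Injective fun k : ℕ => a * x ^ k) : False := by
  let F : Filter Q := map (fun k : ℕ => x ^ k) atTop
  have hFmem : ∀ t, t ∈ F ↔ ∃ N, ∀ k ≥ N, x ^ k ∈ t := fun t => by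
    simp only [F, mem_map, mem_atTop_sets, mem_preimage]
  have hmul : ∀ a, pure a * F = map (fun k : ℕ => a * x ^ k) atTop := fun a => by
    rw [Filter.pure_mul, Filter.map_map]
    rfl
  have hshift : ∀ a (i : ℕ), pure a * F = map (fun k : ℕ => a * x ^ i * x ^ k) atTop := by
    intro a i
    rw [hmul, ← map_add_atTop_eq_nat i, Filter.map_map]
    congr 1
    · funext k
      simp only [Function.comp_apply, pow_add, mul_assoc, mul_comm (x ^ i)]
    · exact (map_add_atTop_eq_nat i).symm
  have hinj : ∀ a b, Function.Injective (fun k : ℕ => a * x ^ k) →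
      Disjoint (pure a * F) (pure b) := fun a b ha => by
    rw [hmul]
    have : {b}ᶜ ∈ map (fun k : ℕ => a * x ^ k) cofinite := by
      rw [mem_map, mem_cofinite, ← preimage_compl, compl_compl]
      exact (finite_singleton b).preimage ha.injOn
    exact Filter.disjoint_iff.2 ⟨{b}ᶜ, by rwa [← Nat.cofinite_eq_atTop], {b}, mem_pure.2 rfl,
      disjoint_compl_left⟩
  have hFF : F * F = F := by
    refine le_antisymm (fun t ht => ?_) fun t ht => ?_
    · obtain ⟨N, hN⟩ := (hFmem t).1 ht
      refine Filter.mem_mul.2 ⟨{y | ∃ k ≥ N, y = x ^ k}, (hFmem _).2 ⟨N, fun k hk => ⟨k, hk, rfl⟩⟩,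
        {y | ∃ k ≥ N, y = x ^ k}, (hFmem _).2 ⟨N, fun k hk => ⟨k, hk, rfl⟩⟩, ?_⟩
      rintro _ ⟨_, ⟨k, hk, rfl⟩, _, ⟨l, -, rfl⟩, rfl⟩
      simpa only [← pow_add] using hN _ (by omega)
    · obtain ⟨t₁, h₁, t₂, h₂, ht⟩ := Filter.mem_mul.1 ht
      obtain ⟨N₁, hN₁⟩ := (hFmem _).1 h₁
      obtain ⟨N₂, hN₂⟩ := (hFmem _).1 h₂
      refine (hFmem t).2 ⟨N₁ + N₂, fun k hk => ht ?_⟩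
      refine ⟨x ^ N₁, hN₁ _ le_rfl, x ^ (k - N₁), hN₂ _ (by omega), ?_⟩
      simp only [← pow_add]
      congr 1
      omega
  have hne : ¬ ∃ q, F = pure q := by
    rintro ⟨q, hq⟩
    have := hinj 1 q (by simpa using hx)
    rw [Filter.pure_one, one_mul, hq] at this
    exact Filter.disjoint_pure_pure.1 this rfl
  refine hne (hQ.exists_eq_pure (F := F)
    ⟨1, Or.inr (by rw [hFF, Filter.pure_one, one_mul])⟩ (fun a b => ?_) fun a b => ?_)
  · by_cases hab : ∃ i j : ℕ, a * x ^ i = b * x ^ j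
    · obtain ⟨i, j, hab⟩ := hab
      left
      rw [hshift a i, hab, ← hshift b j]
    · right
      rw [hmul, hmul]
      refine Filter.disjoint_iff.2 ⟨_, range_mem_map, _, range_mem_map, ?_⟩
      rw [Set.disjoint_left]
      rintro _ ⟨i, rfl⟩ ⟨j, hj⟩
      exact hab ⟨i, j, hj.symm⟩
  · rcases h a with ha | ha
    · have hpow : ∀ k : ℕ, a * x ^ k = a := fun k => by
        induction k with
        | zero => simp
        | succ k ih => rw [pow_succ', ← mul_assoc, ha, ih]
      have : pure a * F = pure a := by
        rw [hmul]
        simp only [hpow]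
        exact Filter.map_const
      rw [this]
      by_cases hab : a = b
      · exact Or.inl (hab ▸ rfl)
      · exact Or.inr (Filter.disjoint_pure_pure.2 hab)
    · exact Or.inr (hinj a b ha)

end Periodic

theorem exists_pow_idem_of_pow_eq {M : Type*} [Monoid M] {x : M} {i j : ℕ} (hij : i < j)
    (h : x ^ i = x ^ j) : ∃ n, 0 < n ∧ x ^ n * x ^ n = x ^ n := by
  obtain ⟨p, hp, rfl⟩ : ∃ p, 0 < p ∧ j = i + p := ⟨j - i, by omega, by omega⟩
  have h1 : ∀ k m, x ^ (i + m) = x ^ (i + m + k * p) := by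
    intro k m
    induction k with
    | zero => simp
    | succ k ih =>
      rw [ih, show i + m + (k + 1) * p = i + p + (m + k * p) by ring, pow_add x (i + p), ← h,
        ← pow_add]
      congr 1
      ring
  obtain ⟨q, rfl⟩ : ∃ q, p = q + 1 := ⟨p - 1, by omega⟩
  refine ⟨(i + 1) * (q + 1), by positivity, ?_⟩
  rw [← pow_add]
  have := h1 (i + 1) (i * q + q + 1)
  rw [show i + (i * q + q + 1) = (i + 1) * (q + 1) by ring] at this
  exact this.symm

theorem rees_eq_iff {M : Type*} [CommMonoid M] {I : Set M} (hI : IsIdealSet M I) {a b : M} :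
    (a : (ReesCon I hI).Quotient) = b ↔ a = b ∨ (a ∈ I ∧ b ∈ I) :=
  Con.eq _

theorem isIdealSet_of_mul_mem {M : Type*} [CommSemigroup M] {I : Set M}
    (h : ∀ x ∈ I, ∀ y, x * y ∈ I) : IsIdealSet M I :=
  fun x hx y => ⟨h x hx y, mul_comm x y ▸ h x hx y⟩

theorem AbsolutelyT2SClosed.quotient {M : Type u} [CommMonoid M] (hM : AbsolutelyT2SClosed M)
    (c : Con M) : AbsolutelyT2SClosed c.Quotient :=
  hM.of_surjective (c.mk' : M →ₙ* c.Quotient) Con.mk'_surjective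

theorem AbsolutelyT2SClosed.exists_pow_idem {M : Type u} [CommMonoid M]
    (hM : AbsolutelyT2SClosed M) (x : M) : ∃ n, 0 < n ∧ x ^ n * x ^ n = x ^ n := by
  by_contra hcon
  have hx : Function.Injective fun k : ℕ => x ^ k := fun i j hij => by
    by_contra hne
    rcases lt_or_gt_of_ne hne with h | h
    · exact hcon (exists_pow_idem_of_pow_eq h hij)
    · exact hcon (exists_pow_idem_of_pow_eq h hij.symm)
  let I : Set M := {a | ∀ k, ¬ a ∣ x ^ k}
  have hI : IsIdealSet M I := isIdealSet_of_mul_mem fun a ha b k hk =>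
    ha k ((Dvd.intro _ rfl).trans hk)
  have hIx : ∀ a k, a * x ^ k ∈ I → a ∈ I := fun a k h m ⟨c, hc⟩ =>
    h (m + k) ⟨c, by rw [pow_add, hc, mul_right_comm]⟩
  have hinj : ∀ a ∉ I, Function.Injective fun k : ℕ =>
      (a : (ReesCon I hI).Quotient) * (x : (ReesCon I hI).Quotient) ^ k := by
    intro a ha i j hij
    have hij : ((a * x ^ i : M) : (ReesCon I hI).Quotient) = (a * x ^ j : M) := hij
    rcases (rees_eq_iff hI).1 hij with h | h
    · obtain ⟨k, c, hc⟩ : ∃ k, a ∣ x ^ k := by simpa [I] using ha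
      have : x ^ (k + i) = x ^ (k + j) := by
        rw [pow_add, pow_add, hc, mul_right_comm, h, mul_right_comm]
      simpa using hx this
    · exact (ha (hIx _ _ h.1)).elim
  refine (hM.quotient (ReesCon I hI)).not_injective_pow (x : (ReesCon I hI).Quotient) ?_ ?_
  · have h1 : (1 : M) ∉ I := fun h => h 0 (one_dvd _)
    have := hinj 1 h1
    simpa using this
  · intro a
    induction a using Con.induction_on with | H a => ?_
    by_cases ha : a ∈ I
    · left
      exact (rees_eq_iff hI).2 (Or.inr ⟨(hI a ha x).1, ha⟩)
    · exact Or.inr (hinj a ha)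

section Units

theorem exists_circle_character {G : Type*} [CommGroup G] {g : G} (hg : g ≠ 1) :
    ∃ χ : G →* Circle, χ g ≠ 1 := by
  obtain ⟨χ, hχ⟩ := CharacterModule.exists_character_apply_ne_zero_of_ne_zero
    (a := Additive.ofMul g) (by simpa using hg)
  let χ' : Additive G →+ AddCircle (1 : ℚ) := χ
  let ι : AddCircle (1 : ℚ) →+ AddCircle (1 : ℝ) :=
    QuotientAddGroup.map _ _ (Rat.castHom ℝ).toAddMonoidHom <| by
      rw [AddSubgroup.zmultiples_le]
      exact ⟨1, by simp⟩
  have hι : Function.Injective ι := by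
    rw [injective_iff_map_eq_zero]
    intro a
    induction a using QuotientAddGroup.induction_on with | H q => ?_
    intro h
    obtain ⟨n, hn⟩ := (AddCircle.coe_eq_zero_iff (1 : ℝ)).1 (h : ((q : ℝ) : AddCircle (1 : ℝ)) = 0)
    refine (AddCircle.coe_eq_zero_iff (1 : ℚ)).2 ⟨n, ?_⟩
    have : (n : ℝ) = q := by simpa using hn
    simpa using (by exact_mod_cast this : (n : ℚ) = q)
  refine ⟨{ toFun := fun a => AddCircle.toCircle (ι (χ' (Additive.ofMul a)))
            map_one' := by simp
            map_mul' := fun a b => by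
              rw [ofMul_mul, map_add, map_add, AddCircle.toCircle_add] }, fun h => hχ ?_⟩
  have h : AddCircle.toCircle (ι (χ' (Additive.ofMul g))) =
      AddCircle.toCircle (0 : AddCircle (1 : ℝ)) := by
    rw [AddCircle.toCircle_zero]
    exact h
  exact hι (a₁ := χ' _) (a₂ := 0) ((AddCircle.injective_toCircle one_ne_zero h).trans (map_zero ι).symm)

/-- A countable group with a compact Hausdorff shift-continuous topology is finite. -/
theorem finite_of_compact_countable_group {G : Type*} [Group G] [Countable G]
    [TopologicalSpace G] [T2Space G] [CompactSpace G]
    (hG : ∀ a : G, Continuous fun x : G => a * x) : Finite G := by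
  obtain ⟨c, hc⟩ := nonempty_interior_of_iUnion_of_closed (f := fun c : G => {c})
    (fun c => isClosed_singleton) (iUnion_of_singleton G)
  have hco : IsOpen {c} := by
    rw [← subset_singleton_iff_eq.1 interior_subset |>.resolve_left hc.ne_empty]
    exact isOpen_interior
  have : DiscreteTopology G := by
    refine discreteTopology_iff_isOpen_singleton.2 fun d => ?_
    convert hco.preimage (hG (c * d⁻¹)) using 1
    ext x
    simp [mul_assoc, inv_mul_eq_one, eq_comm]
  exact finite_of_compact_of_discrete

open Classical in
/-- The homomorphism sending units to themselves and the other elements to zero. -/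
noncomputable def toWithZeroUnits (Q : Type*) [CommMonoid Q] : Q →* WithZero Qˣ where
  toFun q := if h : IsUnit q then ((h.unit : Qˣ) : WithZero Qˣ) else 0
  map_one' := by
    rw [dif_pos isUnit_one, IsUnit.unit_one, WithZero.coe_one]
  map_mul' a b := by
    by_cases ha : IsUnit a
    · by_cases hb : IsUnit b
      · rw [dif_pos ha, dif_pos hb, dif_pos (ha.mul hb), ← WithZero.coe_mul, ← IsUnit.unit_mul]
      · rw [dif_neg hb, mul_zero, dif_neg fun h => hb (isUnit_of_mul_isUnit_right h)]
    · rw [dif_neg ha, zero_mul, dif_neg fun h => ha (isUnit_of_mul_isUnit_left h)]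

theorem toWithZeroUnits_coe {Q : Type*} [CommMonoid Q] (u : Qˣ) :
    toWithZeroUnits Q u = (u : WithZero Qˣ) := by
  refine (dif_pos u.isUnit).trans ?_
  rw [u.isUnit.unit_of_val_units]

theorem toWithZeroUnits_of_not_isUnit {Q : Type*} [CommMonoid Q] {q : Q} (h : ¬ IsUnit q) :
    toWithZeroUnits Q q = 0 :=
  dif_neg h

theorem AbsolutelyT2SClosed.finite_units {Q : Type u} [CommMonoid Q]
    (hQ : AbsolutelyT2SClosed Q) : Finite Qˣ := by
  by_contra hinf
  rw [not_finite_iff_infinite] at hinf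
  let f : ℕ ↪ Qˣ := Infinite.natEmbedding Qˣ
  let C : Subgroup Qˣ := (FreeGroup.lift f).range
  have hCc : Countable C := by
    have : Countable (FreeGroup ℕ) := Quot.mk_surjective.countable
    exact (FreeGroup.lift f).rangeRestrict_surjective.countable
  have hCi : Infinite C := Infinite.of_injective
    (fun n => (⟨f n, FreeGroup.of n, by simp⟩ : C)) fun i j h =>
      f.injective (congrArg Subtype.val h)
  let h : Q →ₙ* ((Qˣ →* Circle) → ℂ) :=
    { toFun := fun q χ => WithZero.lift' (Circle.coeHom.comp χ) (toWithZeroUnits Q q)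
      map_mul' := fun a b => by
        funext χ
        rw [map_mul, map_mul]
        rfl }
  have hu : ∀ (c : Qˣ) χ, h c χ = χ c := fun c χ => by
    change WithZero.lift' _ (toWithZeroUnits Q c) = _
    rw [toWithZeroUnits_coe]
    rfl
  have hn : ∀ q, ¬ IsUnit q → ∀ χ, h q χ = 0 := fun q hq χ => by
    change WithZero.lift' _ (toWithZeroUnits Q q) = _
    rw [toWithZeroUnits_of_not_isUnit hq, map_zero]
  have hrange : range (fun c : C => h (c : Qˣ)) = range h ∩ ((univ.pi fun _ => Metric.sphere 0 1) ∩
      ⋂ (χ : Qˣ →* Circle) (_ : ∀ c ∈ C, χ c = 1), {y | y χ = 1}) := by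
    ext y
    simp only [mem_inter_iff, mem_iInter, mem_pi, mem_univ, true_imp_iff, mem_ofPred_eq,
      mem_sphere_zero_iff_norm]
    constructor
    · rintro ⟨c, rfl⟩
      refine ⟨mem_range_self _, fun χ => ?_, fun χ hχ => ?_⟩ <;> beta_reduce
      · rw [hu, Circle.norm_coe]
      · rw [hu, hχ c c.2, Circle.coe_one]
    · rintro ⟨⟨q, rfl⟩, h1, h2⟩
      have hq : IsUnit q := by
        by_contra hq
        have := h1 1
        rw [hn q hq, norm_zero] at this
        exact zero_ne_one this
      obtain ⟨g, rfl⟩ := hq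
      have hg : g ∈ C := by
        by_contra hg
        obtain ⟨χ, hχ⟩ := exists_circle_character (g := (g : Qˣ ⧸ C))
          (fun h => hg ((QuotientGroup.eq_one_iff g).1 h))
        have := h2 (χ.comp (QuotientGroup.mk' C)) fun c hc => by
          rw [MonoidHom.comp_apply, QuotientGroup.mk'_apply, (QuotientGroup.eq_one_iff c).2 hc,
            map_one]
        rw [hu] at this
        exact hχ (Circle.ext this)
      exact ⟨⟨g, hg⟩, rfl⟩
  have hcomp : IsCompact (range fun c : C => h (c : Qˣ)) := by
    rw [hrange, inter_comm, inter_assoc]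
    refine (isCompact_univ_pi fun _ => isCompact_sphere _ _).inter_right (IsClosed.inter ?_ (hQ _ h))
    exact isClosed_iInter fun χ => isClosed_iInter fun _ =>
      isClosed_eq (continuous_apply χ) continuous_const
  have hinj : Function.Injective fun c : C => h (c : Qˣ) := fun c d hcd => by
    by_contra hne
    obtain ⟨χ, hχ⟩ := exists_circle_character (g := (c : Qˣ) / d)
      (fun h => hne (Subtype.ext (div_eq_one.1 h)))
    have := congrFun hcd χ
    simp only [hu] at this
    exact hχ (by rw [map_div, Circle.ext this, div_self'])
  let T : TopologicalSpace C := TopologicalSpace.induced (fun c : C => h (c : Qˣ)) inferInstance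
  have hind : Topology.IsInducing fun c : C => h (c : Qˣ) := ⟨rfl⟩
  have hemb : Topology.IsEmbedding fun c : C => h (c : Qˣ) := ⟨hind, hinj⟩
  have : T2Space C := hemb.t2Space
  have : CompactSpace C := ⟨hind.isCompact_iff.2 (by rwa [image_univ])⟩
  refine (not_finite_iff_infinite.2 hCi) (finite_of_compact_countable_group fun a => ?_)
  refine hind.continuous_iff.2 ?_
  have : (fun c : C => h (c : Qˣ)) ∘ (fun x => a * x) = fun x : C => h (a : Qˣ) * h (x : Qˣ) := by
    funext x
    rw [← map_mul]
    rfl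
  rw [this]
  exact continuous_const.mul hind.continuous

end Units

section Nil

variable {M : Type u} [CommMonoid M]

open Filter in
open scoped Pointwise in
theorem AbsolutelyT2SClosed.not_infinite_null (hM : AbsolutelyT2SClosed M) {J A : Set M}
    (hJ : IsIdealSet M J) (hA : A.Infinite) (hAJ : Disjoint A J)
    (hmul : ∀ a ∈ A, ∀ b ∈ A, a * b ∈ J) : False := by
  obtain ⟨a₀, ha₀⟩ := hA.nonempty
  have hj := hmul a₀ ha₀ a₀ ha₀
  set j := a₀ * a₀
  have := hA.cofinite_inf_principal_neBot
  let V : Ultrafilter M := Ultrafilter.of (cofinite ⊓ 𝓟 A)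
  have hV : (V : Filter M) ≤ cofinite ⊓ 𝓟 A := Ultrafilter.of_le _
  let p : M → (ReesCon J hJ).Quotient := fun x => x
  let U : Ultrafilter (ReesCon J hJ).Quotient := V.map p
  have hAU : p '' A ∈ (U : Filter (ReesCon J hJ).Quotient) :=
    image_mem_map (hV (mem_inf_of_right (mem_principal_self A)))
  obtain ⟨q, hq⟩ := (hM.quotient (ReesCon J hJ)).exists_eq_pure_ultrafilter U
    ⟨p j, Or.inl (by
      have : ((U : Filter (ReesCon J hJ).Quotient) * U).NeBot :=
        Filter.NeBot.mul inferInstance inferInstance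
      refine this.le_pure_iff.1 (le_pure_iff.2 (Filter.mem_mul.2 ⟨_, hAU, _, hAU, ?_⟩))
      rintro _ ⟨_, ⟨a, ha, rfl⟩, _, ⟨b, hb, rfl⟩, rfl⟩
      exact (rees_eq_iff hJ).2 (Or.inr ⟨hmul a ha b hb, hj⟩))⟩
  have hqU : p ⁻¹' {q} ∈ (V : Filter M) := by
    have : {q} ∈ (U : Filter (ReesCon J hJ).Quotient) := by rw [hq]; exact mem_pure.2 rfl
    exact this
  have hqA : p ⁻¹' {q} ∩ A ∈ (V : Filter M) :=
    inter_mem hqU (hV (mem_inf_of_right (mem_principal_self A)))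
  have hfin : (p ⁻¹' {q} ∩ A).Finite := by
    refine Set.Subsingleton.finite fun x hx y hy => ?_
    have hxy : p x = p y := hx.1.trans hy.1.symm
    rcases (rees_eq_iff hJ).1 hxy with h | h
    · exact h
    · exact (disjoint_left.1 hAJ hx.2 h.1).elim
  have hcompl : (p ⁻¹' {q} ∩ A)ᶜ ∈ (V : Filter M) :=
    hV (mem_inf_of_left hfin.compl_mem_cofinite)
  exact Ultrafilter.compl_mem_iff_notMem.1 hcompl hqA

/-- The nil part of an ideal of an absolutely `T₂S`-closed monoid is finite. -/
theorem AbsolutelyT2SClosed.finite_root_diff (hM : AbsolutelyT2SClosed M) {I : Set M}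
    (hI : IsIdealSet M I) : {x : M | (∃ n, 0 < n ∧ x ^ n ∈ I) ∧ x ∉ I}.Finite := by
  by_contra hinf
  change Set.Infinite _ at hinf
  let R : Set M := {x | ∃ n, 0 < n ∧ x ^ n ∈ I}
  have hIm : ∀ {x}, x ∈ I → ∀ y, x * y ∈ I := fun hx y => (hI _ hx y).1
  have hRm : ∀ {x}, x ∈ R → ∀ y, x * y ∈ R := by
    rintro x ⟨n, hn, hx⟩ y
    exact ⟨n, hn, by rw [mul_pow]; exact hIm hx _⟩
  by_cases hprinc : ∃ a ∈ R, (range (a * ·) \ I).Infinite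
  · obtain ⟨a, ⟨n, hn, han⟩, ha⟩ := hprinc
    have hex : ∃ m, (range (a ^ m * ·) \ I).Finite := by
      refine ⟨n, Set.Finite.subset finite_empty ?_⟩
      rintro _ ⟨⟨y, rfl⟩, hy⟩
      exact hy (hIm han y)
    classical
    have hfind := Nat.find_spec hex
    have hmin := fun k hk => Nat.find_min hex (m := k) hk
    set m := Nat.find hex
    obtain ⟨k, hk⟩ : ∃ k, m = k + 1 + 1 := by
      refine ⟨m - 2, ?_⟩
      by_contra hne
      have hm : m = 0 ∨ m = 1 := by omega
      refine ha (hfind.subset ?_)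
      rintro _ ⟨⟨y, rfl⟩, hy⟩
      refine ⟨?_, hy⟩
      rcases hm with hm | hm
      · exact ⟨a * y, by simp [hm]⟩
      · exact ⟨y, by simp [hm]⟩
    have hinfk := hmin (k + 1) (by omega)
    rw [hk] at hfind
    have hsub : ∀ y, y ∈ range (a ^ (k + 1 + (k + 1)) * ·) → y ∈ range (a ^ (k + 1 + 1) * ·) := by
      rintro _ ⟨y, rfl⟩
      exact ⟨a ^ k * y, by simp only [← mul_assoc, ← pow_add]; congr 2; omega⟩
    let J : Set M := I ∪ range (a ^ (k + 1 + (k + 1)) * ·)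
    have hJ : IsIdealSet M J := isIdealSet_of_mul_mem <| by
      rintro x (hx | ⟨z, rfl⟩) y
      · exact Or.inl (hIm hx y)
      · exact Or.inr ⟨z * y, (mul_assoc _ _ _).symm⟩
    refine hM.not_infinite_null (A := range (a ^ (k + 1) * ·) \ J) hJ ?_ disjoint_sdiff_left ?_
    · have : range (a ^ (k + 1) * ·) \ J =
          (range (a ^ (k + 1) * ·) \ I) \ (range (a ^ (k + 1 + (k + 1)) * ·) \ I) := by
        ext y
        simp only [J, mem_sdiff, mem_union]
        tauto
      rw [this]
      exact Set.Infinite.sdiff hinfk (hfind.subset fun y hy => ⟨hsub y hy.1, hy.2⟩)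
    · rintro _ ⟨⟨x, rfl⟩, -⟩ _ ⟨⟨y, rfl⟩, -⟩
      exact Or.inr ⟨x * y, by simp only [pow_add]; rw [mul_mul_mul_comm]⟩
  have hprinc : ∀ a ∈ R, (range (a * ·) \ I).Finite := fun a ha => by
    by_contra h
    exact hprinc ⟨a, ha, h⟩
  let D : Set M := {x | x ∈ R ∧ x ∉ I ∧ ∀ y ∈ R, ∀ z ∈ R, x ≠ y * z}
  by_cases hD : D.Finite
  swap
  · let J : Set M := {x | x ∈ I ∨ ∃ y ∈ R, ∃ z ∈ R, x = y * z}
    have hJ : IsIdealSet M J := isIdealSet_of_mul_mem <| by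
      rintro x (hx | ⟨z, hz, w, hw, rfl⟩) y
      · exact Or.inl (hIm hx y)
      · exact Or.inr ⟨z, hz, w * y, hRm hw y, mul_assoc _ _ _⟩
    refine hM.not_infinite_null (A := D) hJ hD (disjoint_left.2 ?_)
      fun a ha b hb => Or.inr ⟨a, ha.1, b, hb.1, rfl⟩
    rintro x ⟨-, hxI, hx⟩ (h | ⟨y, hy, z, hz, rfl⟩)
    · exact hxI h
    · exact hx y hy z hz rfl
  have hDM : (⋃ d ∈ D, range (d * ·) \ I).Finite := hD.biUnion fun d hd => hprinc d hd.1
  let B : Set M := {x | x ∈ R ∧ x ∉ I ∧ ∀ d ∈ D, ∀ m, x ≠ d * m}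
  obtain ⟨x₀, ⟨hx₀R, hx₀I⟩, hx₀⟩ := (hinf.sdiff hDM).nonempty
  have hx₀B : x₀ ∈ B := ⟨hx₀R, hx₀I, fun d hd m h =>
    hx₀ (mem_biUnion hd ⟨⟨m, h.symm⟩, hx₀I⟩)⟩
  have hstep : ∀ x : B, ∃ (y : B) (z : R), (x : M) = y * z := by
    rintro ⟨x, hxR, hxI, hxD⟩
    have : x ∉ D := fun h => hxD x h 1 (mul_one x).symm
    have : ∃ y ∈ R, ∃ z ∈ R, x = y * z := by
      by_contra! h
      exact this ⟨hxR, hxI, h⟩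
    obtain ⟨y, hy, z, hz, rfl⟩ := this
    exact ⟨⟨y, hy, fun h => hxI (hIm h z), fun d hd m h =>
      hxD d hd (m * z) (by rw [h, mul_assoc])⟩, ⟨z, hz⟩, rfl⟩
  choose y z hyz using hstep
  let x : ℕ → B := fun n => y^[n] ⟨x₀, hx₀B⟩
  have hx : ∀ n, (x n : M) = x (n + 1) * z (x n) := fun n => by
    simp only [x, Function.iterate_succ_apply']
    exact hyz _
  let P : ℕ → M := fun n => ∏ i ∈ Finset.range n, (z (x i) : M)
  have hP : ∀ n, x₀ = x n * P n := by
    intro n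
    induction n with
    | zero => simp [x, P]
    | succ n ih =>
      rw [ih, hx n]
      simp only [P, Finset.prod_range_succ]
      rw [mul_assoc, mul_comm (z (x n) : M)]
  have hPI : ∀ n, P n ∉ I := fun n h => hx₀I <| by
    rw [hP n, mul_comm]
    exact hIm h _
  have hmaps : MapsTo (fun n => P (n + 1)) univ (range ((z (x 0) : M) * ·) \ I) := fun n _ =>
    ⟨⟨∏ i ∈ Finset.range n, (z (x (i + 1)) : M), by
      simp only [P, Finset.prod_range_succ', mul_comm]⟩, hPI _⟩
  obtain ⟨n, -, m, -, hnm, heq⟩ := infinite_univ.exists_lt_map_eq_of_mapsTo hmaps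
    (hprinc _ (z (x 0)).2)
  obtain ⟨w, ⟨k, -, hw⟩, hPw⟩ : ∃ w ∈ R, P (m + 1) = P (n + 1) * w := by
    refine ⟨∏ i ∈ Finset.Ico (n + 1) (m + 1), (z (x i) : M), ?_,
      (Finset.prod_range_mul_prod_Ico _ (by omega)).symm⟩
    rw [Finset.prod_eq_prod_Ico_succ_bot (by omega)]
    exact hRm (z (x (n + 1))).2 _
  have hPk : ∀ k : ℕ, P (n + 1) = P (n + 1) * w ^ k := by
    intro k
    induction k with
    | zero => simp
    | succ k ih => rw [pow_succ', ← mul_assoc, ← hPw, ← heq, ← ih]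
  refine hPI (n + 1) ?_
  rw [hPk k, mul_comm]
  exact hIm hw _

end Nil

section Clifford

variable {M : Type u} [CommMonoid M]

/-- The congruence identifying elements with the same product with `e`. -/
def mulRightCon (e : M) : Con M where
  r x y := x * e = y * e
  iseqv := ⟨fun _ => rfl, Eq.symm, Eq.trans⟩
  mul' := by
    intro a b c d (hab : a * e = b * e) (hcd : c * e = d * e)
    rw [mul_assoc, hcd, mul_left_comm, hab, mul_left_comm, mul_assoc]

theorem mulRightCon_eq {e a b : M} :
    (a : (mulRightCon e).Quotient) = b ↔ a * e = b * e :=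
  Con.eq _

theorem isUnit_mulRightCon {e u v : M} (he : e * e = e) (h : u * v = e) :
    IsUnit (u : (mulRightCon e).Quotient) :=
  IsUnit.of_mul_eq_one (v : (mulRightCon e).Quotient)
    ((mulRightCon_eq (e := e) (a := u * v) (b := 1)).2 (by rw [h, he, one_mul]))

theorem AbsolutelyT2SClosed.finite_subgroup (hM : AbsolutelyT2SClosed M) {e : M}
    (he : e * e = e) : {u : M | u * e = u ∧ ∃ v, u * v = e}.Finite := by
  have := (hM.quotient (mulRightCon e)).finite_units
  refine Set.Finite.of_finite_image (f := fun u : M => (u : (mulRightCon e).Quotient))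
    ((finite_range (Units.val : (mulRightCon e).Quotientˣ → _)).subset ?_) ?_
  · rintro _ ⟨u, ⟨-, v, hv⟩, rfl⟩
    exact isUnit_mulRightCon he hv
  · intro u hu v hv huv
    rw [← hu.1, ← hv.1]
    exact mulRightCon_eq.1 huv

/-- The idempotent power of an element. -/
noncomputable def AbsolutelyT2SClosed.idemPow (hM : AbsolutelyT2SClosed M) (x : M) : Idem M :=
  ⟨_, (hM.exists_pow_idem x).choose_spec.2⟩

namespace AbsolutelyT2SClosed

theorem exists_idemPow_eq (hM : AbsolutelyT2SClosed M) (x : M) :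
    ∃ n, 0 < n ∧ (hM.idemPow x).1 = x ^ n :=
  ⟨_, (hM.exists_pow_idem x).choose_spec.1, rfl⟩

theorem idemPow_eq (hM : AbsolutelyT2SClosed M) {x : M} {n : ℕ} (hn : 0 < n)
    (h : x ^ n * x ^ n = x ^ n) : (hM.idemPow x).1 = x ^ n := by
  obtain ⟨m, hm, hx⟩ := hM.exists_idemPow_eq x
  have h1 : (hM.idemPow x).1 ^ n = (hM.idemPow x).1 :=
    IsIdempotentElem.pow_eq (hM.idemPow x).2 hn.ne'
  have h2 : (x ^ n) ^ m = x ^ n := IsIdempotentElem.pow_eq h hm.ne'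
  rw [← h1, ← h2, hx, pow_right_comm]

theorem idemPow_of_idem (hM : AbsolutelyT2SClosed M) (e : Idem M) : hM.idemPow e.1 = e := by
  have := hM.idemPow_eq (x := e.1) one_pos (by rw [pow_one, e.2])
  exact Subtype.ext (by rw [this, pow_one])

theorem idemPow_mul (hM : AbsolutelyT2SClosed M) (x y : M) :
    hM.idemPow (x * y) = hM.idemPow x ⊓ hM.idemPow y := by
  obtain ⟨m, hm, hx⟩ := hM.exists_idemPow_eq x
  obtain ⟨n, hn, hy⟩ := hM.exists_idemPow_eq y
  have h1 : (hM.idemPow x).1 ^ n = (hM.idemPow x).1 :=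
    IsIdempotentElem.pow_eq (hM.idemPow x).2 hn.ne'
  have h2 : (hM.idemPow y).1 ^ m = (hM.idemPow y).1 :=
    IsIdempotentElem.pow_eq (hM.idemPow y).2 hm.ne'
  have h3 : (x * y) ^ (m * n) = (hM.idemPow x ⊓ hM.idemPow y).1 := by
    rw [Idem.coe_inf, mul_pow, pow_mul, ← hx, h1, mul_comm m n, pow_mul, ← hy, h2]
  refine Subtype.ext ?_
  rw [← h3]
  refine hM.idemPow_eq (Nat.mul_pos hm hn) ?_
  rw [h3]
  exact (hM.idemPow x ⊓ hM.idemPow y).2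

theorem finite_not_clifford_antichain (hM : AbsolutelyT2SClosed M) {A : Set (Idem M)}
    (hA : IsAntichain (· ≤ ·) A) :
    {x : M | hM.idemPow x ∈ A ∧ x * (hM.idemPow x).1 ≠ x}.Finite := by
  let J : Set M := {x | (∃ m ∈ A, hM.idemPow x ≤ m) ∧
    (hM.idemPow x ∈ A → x * (hM.idemPow x).1 = x)}
  have hJ : IsIdealSet M J := isIdealSet_of_mul_mem <| by
    rintro x ⟨⟨m, hm, hxm⟩, hx⟩ y
    have hle : hM.idemPow (x * y) ≤ hM.idemPow x := by
      rw [hM.idemPow_mul]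
      exact inf_le_left
    refine ⟨⟨m, hm, hle.trans hxm⟩, fun hxy => ?_⟩
    have heq := hA.eq hxy hm (hle.trans hxm)
    have hx' : hM.idemPow x = m := le_antisymm hxm (heq ▸ hle)
    rw [heq, ← hx', mul_right_comm, hx (hx'.symm ▸ hm)]
  refine (hM.finite_root_diff hJ).subset fun x hx => ⟨?_, fun h => hx.2 (h.2 hx.1)⟩
  obtain ⟨n, hn, hxn⟩ := hM.exists_idemPow_eq x
  refine ⟨n, hn, ?_⟩
  rw [← hxn]
  exact ⟨⟨_, hx.1, (hM.idemPow_of_idem _).le⟩, fun _ => by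
    rw [hM.idemPow_of_idem, (hM.idemPow x).2]⟩

theorem finite_not_clifford (hM : AbsolutelyT2SClosed M) :
    {x : M | x * (hM.idemPow x).1 ≠ x}.Finite := by
  by_contra hinf
  change Set.Infinite _ at hinf
  have himg : (hM.idemPow '' {x : M | x * (hM.idemPow x).1 ≠ x}).Infinite := fun hfin => by
    refine hinf ((hfin.biUnion fun e _ => hM.finite_not_clifford_antichain
      (A := {e}) (Set.subsingleton_singleton.isAntichain _)).subset fun x hx => ?_)
    exact mem_biUnion (mem_image_of_mem _ hx) ⟨rfl, hx⟩
  let f := himg.natEmbedding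
  obtain ⟨g, hg⟩ := hM.exists_antichain (fun n => (f n).1)
    (Subtype.val_injective.comp f.injective)
  have hanti : IsAntichain (· ≤ ·) (range fun n => (f (g n)).1) := by
    rintro _ ⟨m, rfl⟩ _ ⟨n, rfl⟩ hne
    exact hg m n fun h => hne (h ▸ rfl)
  have hinf' : (range fun n => (f (g n)).1).Infinite :=
    infinite_range_of_injective (Subtype.val_injective.comp (f.injective.comp g.injective))
  refine hinf' (((hM.finite_not_clifford_antichain hanti).image hM.idemPow).subset ?_)
  rintro _ ⟨n, rfl⟩
  obtain ⟨x, hx, hxf⟩ := (f (g n)).2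
  exact ⟨x, ⟨⟨n, hxf.symm⟩, hx⟩, hxf⟩

end AbsolutelyT2SClosed

end Clifford

section Escape

open Filter Topology

/-- The filter on `ℕ × ℕ` generated by the sets of pairs `(k, j)` with `k` in a member of `U`,
`r ≤ j` and `m * j ≤ k`. -/
def escapeFilter (U : Filter ℕ) (r : ℕ) : Filter (ℕ × ℕ) where
  sets := {S | ∃ m, ∀ᶠ k in U, ∀ j, r ≤ j → m * j ≤ k → (k, j) ∈ S}
  univ_sets := ⟨0, Eventually.of_forall fun _ _ _ _ => mem_univ _⟩
  sets_of_superset := by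
    rintro S T ⟨m, hm⟩ hST
    exact ⟨m, hm.mono fun k hk j hr hj => hST (hk j hr hj)⟩
  inter_sets := by
    rintro S T ⟨m, hm⟩ ⟨n, hn⟩
    refine ⟨m + n, ?_⟩
    filter_upwards [hm, hn] with k hk hk' j hr hj
    rw [add_mul] at hj
    exact ⟨hk j hr (by omega), hk' j hr (by omega)⟩

theorem escapeFilter_le (U : Filter ℕ) {r s : ℕ} (h : r ≤ s) :
    escapeFilter U s ≤ escapeFilter U r := by
  rintro S ⟨m, hm⟩
  exact ⟨m, hm.mono fun k hk j hr hj => hk j (h.trans hr) hj⟩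

theorem map_le_escapeFilter {U : Filter ℕ} (hU : U ≤ atTop) :
    map (fun k => (k, 1)) U ≤ escapeFilter U 1 := by
  rintro S ⟨m, hm⟩
  refine mem_map.2 ?_
  filter_upwards [hm, hU (eventually_ge_atTop m)] with k hk hmk
  exact hk 1 le_rfl (by simpa using hmk)

theorem tendsto_fst_escapeFilter (U : Filter ℕ) (r : ℕ) :
    Tendsto Prod.fst (escapeFilter U r) U := fun _ hS =>
  ⟨0, Filter.mem_of_superset hS fun _ hk _ _ _ => hk⟩

theorem eventually_add_mem_escapeFilter {U : Filter ℕ} {S : Set (ℕ × ℕ)}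
    (hS : S ∈ escapeFilter U 2) :
    ∀ᶠ p in escapeFilter U 1 ×ˢ escapeFilter U 1, p.1.1 = p.2.1 → (p.1.1, p.1.2 + p.2.2) ∈ S := by
  obtain ⟨m, hm⟩ := hS
  let A : Set (ℕ × ℕ) := {p | 1 ≤ p.2 ∧ 2 * m * p.2 ≤ p.1 ∧
    ∀ j, 2 ≤ j → m * j ≤ p.1 → (p.1, j) ∈ S}
  have hA : A ∈ escapeFilter U 1 := ⟨2 * m, hm.mono fun k hk j hr hj => ⟨hr, hj, hk⟩⟩
  filter_upwards [prod_mem_prod hA hA]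
  rintro ⟨⟨k, i⟩, ⟨l, j⟩⟩ ⟨⟨hi, hki, hk⟩, ⟨hj, hlj, -⟩⟩ (rfl : k = l)
  simp only at hi hki hk hj hlj ⊢
  refine hk _ (by omega) ?_
  rw [mul_assoc] at hki hlj
  rw [mul_add]
  omega

variable (C : ℕ → Type u) [∀ k, CommMonoidWithZero (C k)]

/-- The semigroup of sequences that are `U`-eventually equal to `0` or to `1`, marked by an element of `ZMod 4`. -/
def escapeSemigroup (U : Ultrafilter ℕ) : Subsemigroup ((∀ k, C k) × ZMod 4) where
  carrier := {p | (p.2 = 1 ∧ ∀ᶠ k in U, p.1 k = 1) ∨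
    ((p.2 = 0 ∨ p.2 = 2) ∧ ∀ᶠ k in U, p.1 k = 0)}
  mul_mem' := by
    have h22 : (2 : ZMod 4) * 2 = 0 := rfl
    rintro ⟨f, i⟩ ⟨g, j⟩ (⟨hi, hf⟩ | ⟨hi, hf⟩) (⟨hj, hg⟩ | ⟨hj, hg⟩)
    · refine Or.inl ⟨by simp_all, ?_⟩
      filter_upwards [hf, hg] with k h1 h2
      simp_all
    · refine Or.inr ⟨by simp_all, ?_⟩
      filter_upwards [hg] with k h2
      simp_all
    · refine Or.inr ⟨by simp_all, ?_⟩
      filter_upwards [hf] with k h2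
      simp_all
    · refine Or.inr ⟨?_, ?_⟩
      · rcases hi with rfl | rfl <;> rcases hj with rfl | rfl <;> simp [h22]
      · filter_upwards [hf] with k h2
        simp_all

variable {C}

theorem exists_not_isClosed_range {M : Type u} [Semigroup M] [∀ k, Nontrivial (C k)]
    (ψ : ∀ k, M →ₙ* C k) (x : ℕ → M) (hne : ∀ k l, k ≠ l → ψ k (x l) = 0)
    (hz : ∀ k j, ψ k (x k) ^ j ≠ 0) (hev : ∀ t, ∀ᶠ k in atTop, ψ k t = 0 ∨ ψ k t = 1) :
    ∃ (Y : Type u) (_ : Semigroup Y) (_ : TopologicalSpace Y), ContinuousMul Y ∧ T1Space Y ∧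
      ((∀ k j, 2 ≤ j → j ≤ k → ψ k (x k) ^ j ≠ ψ k (x k)) → T2Space Y) ∧
      ∃ h : M →ₙ* Y, ¬ IsClosed (range h) := by
  classical
  let U : Ultrafilter ℕ := hyperfilter ℕ
  have hU : (U : Filter ℕ) ≤ atTop := Nat.hyperfilter_le_atTop
  have hUne : ∀ l, ∀ᶠ k in (U : Filter ℕ), k ≠ l := fun l => hU (eventually_ne_atTop l)
  let Y := escapeSemigroup C U
  let d : ℕ × ℕ → Y := fun p => ⟨(Pi.single p.1 (ψ p.1 (x p.1) ^ p.2), 0), Or.inr ⟨Or.inl rfl, by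
    filter_upwards [hUne p.1] with k hk
    exact Pi.single_eq_of_ne hk _⟩⟩
  let O : Y := ⟨(0, 0), Or.inr ⟨Or.inl rfl, Eventually.of_forall fun _ => rfl⟩⟩
  let B : Y := ⟨(0, 2), Or.inr ⟨Or.inr rfl, Eventually.of_forall fun _ => rfl⟩⟩
  have h02 : (0 : ZMod 4) ≠ 2 := by decide
  have h12 : (1 : ZMod 4) ≠ 2 := by decide
  have h01 : (0 : ZMod 4) ≠ 1 := by decide
  have hOB : O ≠ B := fun h => h02 (congrArg (fun y : Y => y.1.2) h)
  have hdB : ∀ p, d p ≠ B := fun p h => h02 (congrArg (fun y : Y => y.1.2) h)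
  have hdk : ∀ p, (d p).1.1 p.1 ≠ 0 := fun p => by
    change Pi.single p.1 (ψ p.1 (x p.1) ^ p.2) p.1 ≠ 0
    rw [Pi.single_eq_same]
    exact hz _ _
  have hdl : ∀ p l, l ≠ p.1 → (d p).1.1 l = 0 := fun p l h => Pi.single_eq_of_ne h _
  have hdO : ∀ p, d p ≠ O := fun p h => hdk p (by rw [h]; rfl)
  have hdfst : ∀ p q, d p = d q → p.1 = q.1 := fun p q h => by
    by_contra hpq
    exact hdk p (by rw [h]; exact hdl q _ hpq)
  have hdne : ∀ c : Y, ∀ᶠ k in (U : Filter ℕ), ∀ j, d (k, j) ≠ c := fun c => by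
    by_cases h : ∃ p, d p = c
    · obtain ⟨p, rfl⟩ := h
      filter_upwards [hUne p.1] with k hk j hj
      exact hk (hdfst _ _ hj)
    · exact Eventually.of_forall fun k j hj => h ⟨_, hj⟩
  have hdd : ∀ k i j, d (k, i) * d (k, j) = d (k, i + j) := fun k i j => by
    refine Subtype.ext (Prod.ext ?_ (mul_zero _))
    change Pi.single k _ * Pi.single k _ = Pi.single k _
    rw [← Pi.single_mul, pow_add]
  have hdd' : ∀ p q, p.1 ≠ q.1 → d p * d q = O := fun p q hpq => by
    refine Subtype.ext (Prod.ext (funext fun l => ?_) (mul_zero _))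
    change (d p).1.1 l * (d q).1.1 l = 0
    by_cases hl : l = p.1
    · rw [hdl q l (hl ▸ hpq), mul_zero]
    · rw [hdl p l hl, zero_mul]
  have hmulO : ∀ y, y * O = O := fun y => Subtype.ext (Prod.ext (mul_zero _) (mul_zero _))
  have hcomm : ∀ y y' : Y, y * y' = y' * y := mul_comm
  have hd1 : ∀ y : Y, y.1.2 = 1 → ∀ᶠ k in (U : Filter ℕ), ∀ j, y * d (k, j) = d (k, j) := by
    rintro y hy
    have h1 : ∀ᶠ k in (U : Filter ℕ), y.1.1 k = 1 := by
      rcases y.2 with h | h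
      · exact h.2
      · rcases h.1 with h | h
        · exact (h01 (h.symm.trans hy)).elim
        · exact (h12 (hy.symm.trans h)).elim
    filter_upwards [h1] with k hk j
    refine Subtype.ext (Prod.ext (funext fun l => ?_) (mul_zero _))
    change y.1.1 l * (d (k, j)).1.1 l = (d (k, j)).1.1 l
    by_cases hl : l = k
    · rw [hl, hk, one_mul]
    · rw [hdl (k, j) l hl, mul_zero]
  have hd0 : ∀ y : Y, y.1.2 ≠ 1 → ∀ᶠ k in (U : Filter ℕ), ∀ j, y * d (k, j) = O := by
    rintro y hy
    have h1 : ∀ᶠ k in (U : Filter ℕ), y.1.1 k = 0 := by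
      rcases y.2 with h | h
      · exact (hy h.1).elim
      · exact h.2
    filter_upwards [h1] with k hk j
    refine Subtype.ext (Prod.ext (funext fun l => ?_) (mul_zero _))
    change y.1.1 l * (d (k, j)).1.1 l = 0
    by_cases hl : l = k
    · rw [hl, hk, zero_mul]
    · rw [hdl (k, j) l hl, mul_zero]
  let LO : Filter Y := map d (escapeFilter U 2)
  let LB : Filter Y := map (fun k => d (k, 1)) U
  let N : Y → Filter Y := fun y => if y = O then pure O ⊔ LO else if y = B then pure B ⊔ LB
    else pure y
  have hNO : N O = pure O ⊔ LO := if_pos rfl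
  have hNB : N B = pure B ⊔ LB := (if_neg hOB.symm).trans (if_pos rfl)
  have hNy : ∀ y, y ≠ O → y ≠ B → N y = pure y := fun y h1 h2 => (if_neg h1).trans (if_neg h2)
  have hNd : ∀ p, N (d p) = pure (d p) := fun p => hNy _ (hdO p) (hdB p)
  have hpure : pure ≤ N := fun y => by
    by_cases h1 : y = O
    · rw [h1, hNO]
      exact le_sup_left
    · by_cases h2 : y = B
      · rw [h2, hNB]
        exact le_sup_left
      · rw [hNy y h1 h2]
  let T : TopologicalSpace Y := TopologicalSpace.mkOfNhds N
  have hnhds : ∀ y, 𝓝 y = N y := fun y => TopologicalSpace.nhds_mkOfNhds N y hpure <| by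
    intro a s hs
    by_cases h1 : a = O
    · subst h1
      have hs' := hs
      rw [hNO] at hs ⊢
      refine eventually_sup.2 ⟨eventually_pure.2 hs', eventually_map.2 ?_⟩
      filter_upwards [(mem_sup.1 hs).2] with p hp
      rw [hNd]
      exact mem_pure.2 hp
    · by_cases h2 : a = B
      · subst h2
        have hs' := hs
        rw [hNB] at hs ⊢
        refine eventually_sup.2 ⟨eventually_pure.2 hs', eventually_map.2 ?_⟩
        filter_upwards [(mem_sup.1 hs).2] with p hp
        rw [hNd]
        exact mem_pure.2 hp
      · rw [hNy a h1 h2] at hs ⊢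
        refine eventually_pure.2 ?_
        rwa [hNy a h1 h2]
  let L : Filter Y := map d (escapeFilter U 1)
  have hLO : LO ≤ L := map_mono (escapeFilter_le U one_le_two)
  have hLB : LB ≤ L := by
    have := map_mono (m := d) (map_le_escapeFilter hU)
    rwa [map_map] at this
  have hpureO : ∀ s ∈ N O, O ∈ s := fun s hs => hpure O hs
  have hLev : ∀ {P : Y → Prop}, (∀ᶠ k in (U : Filter ℕ), ∀ j, P (d (k, j))) → ∀ᶠ y in L, P y :=
    fun hP => eventually_map.2 <|
      ((tendsto_fst_escapeFilter U 1).eventually hP).mono fun p hp => hp p.2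
  have hone : ∀ y : Y, y.1.2 = 1 → (∀ᶠ y' in L, y * y' = y') := fun y hy => hLev (hd1 y hy)
  have hzero : ∀ y : Y, y.1.2 ≠ 1 → (∀ᶠ y' in L, y * y' = O) := fun y hy => hLev (hd0 y hy)
  have hyB : ∀ y : Y, y.1.2 = 1 → y * B = B := fun y hy => by
    refine Subtype.ext (Prod.ext (mul_zero _) ?_)
    change y.1.2 * 2 = 2
    rw [hy, one_mul]
  have hyB' : ∀ y : Y, y.1.2 ≠ 1 → y * B = O := fun y hy => by
    refine Subtype.ext (Prod.ext (mul_zero _) ?_)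
    change y.1.2 * 2 = 0
    rcases y.2 with h | h
    · exact (hy h.1).elim
    · rcases h.1 with h | h <;> rw [h] <;> rfl
  have htO : ∀ {F : Filter Y} {f : Y → Y}, (∀ᶠ y in F, f y = O) → Tendsto f F (N O) :=
    fun hF s hs => mem_map.2 (hF.mono fun y hy => by
      rw [hy]
      exact hpureO s hs)
  have hmulL : ∀ s ∈ N O, ∀ᶠ p in L ×ˢ L, p.1 * p.2 ∈ s := fun s hs => by
    have hs' : d ⁻¹' s ∈ escapeFilter U 2 := by
      rw [hNO] at hs
      exact (mem_sup.1 hs).2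
    rw [prod_map_map_eq, eventually_map]
    filter_upwards [eventually_add_mem_escapeFilter hs']
    rintro ⟨⟨k, i⟩, ⟨l, j⟩⟩ hp
    by_cases hkl : k = l
    · have := hp hkl
      simp only at this ⊢
      rw [← hkl, hdd]
      exact this
    · simp only
      rw [hdd' _ _ hkl]
      exact hpureO s hs
  have hleft : ∀ y a, a = O ∨ a = B → Tendsto (fun y' => y * y') (N a) (N (y * a)) := by
    rintro y a (rfl | rfl)
    · rw [hmulO]
      by_cases hy : y.1.2 = 1
      · refine Tendsto.congr' (f₁ := id) ?_ tendsto_id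
        nth_rewrite 1 [hNO]
        refine EventuallyEq.symm (eventually_sup.2 ⟨eventually_pure.2 (hmulO y), ?_⟩)
        exact hLO (hone y hy)
      · refine htO ?_
        rw [hNO]
        exact eventually_sup.2 ⟨eventually_pure.2 (hmulO y), hLO (hzero y hy)⟩
    · by_cases hy : y.1.2 = 1
      · rw [hyB y hy]
        refine Tendsto.congr' (f₁ := id) ?_ tendsto_id
        nth_rewrite 1 [hNB]
        refine EventuallyEq.symm (eventually_sup.2 ⟨eventually_pure.2 (hyB y hy), ?_⟩)
        exact hLB (hone y hy)
      · rw [hyB' y hy]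
        refine htO ?_
        rw [hNB]
        exact eventually_sup.2 ⟨eventually_pure.2 (hyB' y hy), hLB (hzero y hy)⟩
  have hspec : ∀ a, a = O ∨ a = B → a.1.2 ≠ 1 ∧ N a ≤ pure a ⊔ L := by
    rintro a (rfl | rfl)
    · exact ⟨h01, by rw [hNO]; exact sup_le_sup_left hLO _⟩
    · exact ⟨h12.symm, by rw [hNB]; exact sup_le_sup_left hLB _⟩
  have hmul : ∀ a b, Tendsto (fun p : Y × Y => p.1 * p.2) (N a ×ˢ N b) (N (a * b)) := by
    intro a b
    by_cases ha : a = O ∨ a = B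
    · by_cases hb : b = O ∨ b = B
      · have hab : a * b = O := by
          rcases hb with rfl | rfl
          · exact hmulO a
          · exact hyB' a (hspec a ha).1
        rw [hab]
        intro s hs
        have hO := hpureO s hs
        refine mem_map.2 (Filter.mem_of_superset (Filter.prod_mono (hspec a ha).2 (hspec b hb).2
          (?_ : {p : Y × Y | p.1 * p.2 ∈ s} ∈ (pure a ⊔ L) ×ˢ (pure b ⊔ L))) subset_rfl)
        rw [Filter.sup_prod, Filter.prod_sup, Filter.prod_sup]
        refine mem_sup.2 ⟨mem_sup.2 ⟨?_, ?_⟩, mem_sup.2 ⟨?_, hmulL s hs⟩⟩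
        · rw [prod_pure_pure]
          refine mem_pure.2 ?_
          change a * b ∈ s
          rwa [hab]
        · rw [pure_prod]
          refine mem_map.2 ((hzero a (hspec a ha).1).mono fun y hy => ?_)
          change a * y ∈ s
          rwa [hy]
        · rw [prod_pure]
          refine mem_map.2 ((hzero b (hspec b hb).1).mono fun y hy => ?_)
          change y * b ∈ s
          rwa [hcomm, hy]
      · rw [hNy b (fun h => hb (Or.inl h)) (fun h => hb (Or.inr h)), prod_pure, hcomm a b]
        refine tendsto_map'_iff.2 ((hleft b a ha).congr fun y => hcomm b y)
    · rw [hNy a (fun h => ha (Or.inl h)) (fun h => ha (Or.inr h)), pure_prod]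
      refine tendsto_map'_iff.2 ?_
      by_cases hb : b = O ∨ b = B
      · exact hleft a b hb
      · rw [hNy b (fun h => hb (Or.inl h)) (fun h => hb (Or.inr h))]
        exact (tendsto_pure_pure _ _).mono_right (hpure _)
  have hsep : ∀ a c, a ≠ c → {c}ᶜ ∈ N a := by
    intro a c hac
    have hL : ∀ᶠ y in L, y ≠ c := hLev (hdne c)
    by_cases ha : a = O ∨ a = B
    · exact (hspec a ha).2 (mem_sup.2 ⟨mem_pure.2 hac, hL⟩)
    · rw [hNy a (fun h => ha (Or.inl h)) (fun h => ha (Or.inr h))]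
      exact mem_pure.2 hac
  have hsepOB : (∀ k j, 2 ≤ j → j ≤ k → ψ k (x k) ^ j ≠ ψ k (x k)) → Disjoint (N O) (N B) := by
    intro hpow
    rw [hNO, hNB]
    refine Filter.disjoint_iff.2 ⟨insert O (d '' {p | 2 ≤ p.2 ∧ p.2 ≤ p.1}), ?_,
      insert B (range fun k => d (k, 1)), ?_, ?_⟩
    · refine mem_sup.2 ⟨mem_pure.2 (mem_insert _ _), mem_map.2 ⟨1, Eventually.of_forall ?_⟩⟩
      intro k j h2 hj
      exact mem_insert_of_mem _ ⟨(k, j), ⟨h2, by simpa using hj⟩, rfl⟩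
    · refine mem_sup.2 ⟨mem_pure.2 (mem_insert _ _), mem_map.2 (Eventually.of_forall ?_)⟩
      exact fun k => mem_insert_of_mem _ ⟨k, rfl⟩
    · rw [Set.disjoint_left]
      rintro y (rfl | ⟨⟨k, j⟩, ⟨h2, hjk⟩, rfl⟩) (h | ⟨l, h⟩)
      · exact hOB h
      · exact hdO _ h
      · exact hdB _ h
      · have hlk : l = k := hdfst _ _ h
        subst hlk
        have := congrArg (fun y : Y => y.1.1 l) h
        change Pi.single l _ l = Pi.single l _ l at this
        rw [Pi.single_eq_same, Pi.single_eq_same, pow_one] at this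
        exact hpow l j h2 hjk this.symm
  let h : M →ₙ* Y :=
    { toFun := fun t => ⟨(fun k => ψ k t, if ∀ᶠ k in (U : Filter ℕ), ψ k t = 1 then 1 else 0), by
        by_cases ht : ∀ᶠ k in (U : Filter ℕ), ψ k t = 1
        · exact Or.inl ⟨if_pos ht, ht⟩
        · refine Or.inr ⟨Or.inl (if_neg ht), ?_⟩
          filter_upwards [hU (hev t), Ultrafilter.eventually_not.2 ht] with k h1 h2
          exact h1.resolve_right h2⟩
      map_mul' := fun s t => by
        refine Subtype.ext (Prod.ext (funext fun k => map_mul _ _ _) ?_)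
        change ite _ _ _ = ite _ _ _ * ite _ _ _
        by_cases hs : ∀ᶠ k in (U : Filter ℕ), ψ k s = 1
        · rw [if_pos hs, one_mul]
          refine if_congr (eventually_congr ?_) rfl rfl
          filter_upwards [hs] with k hk
          rw [map_mul, hk, one_mul]
        · rw [if_neg hs, zero_mul, if_neg]
          intro hst
          have : ∀ᶠ k in (U : Filter ℕ), False := by
            filter_upwards [hU (hev s), Ultrafilter.eventually_not.2 hs, hst] with k h1 h2 h3
            rw [map_mul, h1.resolve_right h2, zero_mul] at h3
            exact zero_ne_one h3
          exact this.exists.elim fun _ h => h }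
  have hhx : ∀ k, h (x k) = d (k, 1) := fun k => by
    refine Subtype.ext (Prod.ext (funext fun l => ?_) (if_neg fun h => ?_))
    · change ψ l (x k) = Pi.single k (ψ k (x k) ^ 1) l
      by_cases hl : l = k
      · rw [hl, Pi.single_eq_same, pow_one]
      · rw [Pi.single_eq_of_ne hl, hne l k hl]
    · obtain ⟨l, h1, hl⟩ := (h.and (hUne k)).exists
      rw [hne l k hl] at h1
      exact zero_ne_one h1
  have hT1 : T1Space Y := by
    refine ⟨fun c => isOpen_compl_iff.1 (isOpen_iff_mem_nhds.2 fun a ha => ?_)⟩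
    rw [hnhds]
    exact hsep a c ha
  refine ⟨Y, inferInstance, T, ⟨continuous_iff_continuousAt.2 fun p => ?_⟩, hT1, fun hpow => ?_,
    h, fun hcl => ?_⟩
  · have := hmul p.1 p.2
    rwa [← hnhds, ← hnhds, ← hnhds, ← nhds_prod_eq] at this
  · refine t2_iff_nhds.2 fun {a b} hab => ?_
    by_contra hne
    have hdis : ¬ Disjoint (N a) (N b) := by
      rw [← hnhds, ← hnhds]
      exact fun h => hab.ne h.eq_bot
    have hiso : ∀ a b, a ≠ b → ¬ (a = O ∨ a = B) → Disjoint (N a) (N b) := fun a b hab ha => by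
      rw [hNy a (fun h => ha (Or.inl h)) (fun h => ha (Or.inr h))]
      exact Filter.disjoint_iff.2 ⟨{a}, mem_pure.2 rfl, {a}ᶜ, hsep b a hab.symm,
        disjoint_compl_right⟩
    by_cases ha : a = O ∨ a = B
    · by_cases hb : b = O ∨ b = B
      · rcases ha with rfl | rfl <;> rcases hb with rfl | rfl
        · exact hne rfl
        · exact hdis (hsepOB hpow)
        · exact hdis (hsepOB hpow).symm
        · exact hne rfl
      · exact hdis (hiso b a (Ne.symm hne) hb).symm
    · exact hdis (hiso a b hne ha)
  · have hB : B ∈ closure (range h) := by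
      refine mem_closure_iff_nhds.2 fun s hs => ?_
      rw [hnhds, hNB] at hs
      have hev' : ∀ᶠ k in (U : Filter ℕ), d (k, 1) ∈ s := (mem_sup.1 hs).2
      obtain ⟨k, hk⟩ := hev'.exists
      exact ⟨d (k, 1), hk, x k, hhx k⟩
    rw [hcl.closure_eq] at hB
    obtain ⟨t, ht⟩ := hB
    have ht : (if ∀ᶠ k in (U : Filter ℕ), ψ k t = 1 then (1 : ZMod 4) else 0) = 2 :=
      congrArg (fun y : Y => y.1.2) ht
    split_ifs at ht
    · exact h12 ht
    · exact h02 ht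

end Escape

section Escaping

open Filter

variable {M : Type u} [CommMonoid M]

theorem pow_mul_eq_of_dvd {e t : M} {m n : ℕ} (h : t ^ m * e = e) (hmn : m ∣ n) :
    t ^ n * e = e := by
  obtain ⟨k, rfl⟩ := hmn
  induction k with
  | zero => simp
  | succ k ih => rw [mul_add, pow_add, mul_one, mul_assoc, h, ih]

theorem pow_mul_eq_self {e t : M} {n : ℕ} (h : t * e = t) (hn : n ≠ 0) : t ^ n * e = t ^ n := by
  obtain ⟨m, rfl⟩ := Nat.exists_eq_succ_of_ne_zero hn
  rw [pow_succ, mul_assoc, h]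

namespace AbsolutelyT2SClosed

theorem isUnit_mulRightCon_iff (hM : AbsolutelyT2SClosed M) (e : Idem M) (t : M) :
    IsUnit (t : (mulRightCon e.1).Quotient) ↔ e ≤ hM.idemPow t := by
  obtain ⟨n, hn, ht⟩ := hM.exists_idemPow_eq t
  rw [Idem.le_iff, mul_comm]
  constructor
  · intro h
    have h1 : IsUnit ((hM.idemPow t).1 : (mulRightCon e.1).Quotient) := by
      rw [ht]
      exact h.pow n
    have h2 : ((hM.idemPow t).1 : (mulRightCon e.1).Quotient) * (hM.idemPow t).1 =
        (hM.idemPow t).1 := by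
      rw [← Con.coe_mul, (hM.idemPow t).2]
    have h3 := (mulRightCon_eq (b := 1)).1 (h1.mul_eq_right.1 h2)
    rwa [one_mul] at h3
  · intro h
    refine isUnit_mulRightCon (v := t ^ (n - 1) * e.1) e.2 ?_
    rw [← mul_assoc, mul_pow_sub_one hn.ne', ← ht, h]

theorem exists_not_isClosed_range_of_antichain (hM : AbsolutelyT2SClosed M) {e : ℕ → Idem M}
    (he : ∀ k l, k ≠ l → ¬ e k ≤ e l) {x : ℕ → M} (hx : ∀ k, hM.idemPow (x k) = e k)
    {c : ℕ → ℕ} (hc : ∀ k, c k ≠ 0)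
    (hev : ∀ t, ∀ᶠ k in atTop, e k ≤ hM.idemPow t → t ^ c k * (e k).1 = (e k).1) :
    ∃ (Y : Type u) (_ : Semigroup Y) (_ : TopologicalSpace Y), ContinuousMul Y ∧ T1Space Y ∧
      ((∀ k j, 2 ≤ j → j ≤ k → x k ^ (c k * j) * (e k).1 ≠ x k ^ c k * (e k).1) → T2Space Y) ∧
      ∃ h : M →ₙ* Y, ¬ IsClosed (range h) := by
  let Q : ℕ → Type u := fun k => (mulRightCon (e k).1).Quotient
  let φ : ∀ k, M →* WithZero (Q k)ˣ := fun k =>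
    (toWithZeroUnits (Q k)).comp (mulRightCon (e k).1).mk'
  have hφ0 : ∀ k t, ¬ e k ≤ hM.idemPow t → φ k t = 0 := fun k t h =>
    toWithZeroUnits_of_not_isUnit (mt (hM.isUnit_mulRightCon_iff (e k) t).1 h)
  have hφ : ∀ k t, e k ≤ hM.idemPow t →
      ∃ u : (Q k)ˣ, (u : Q k) = (mulRightCon (e k).1).mk' t ∧ φ k t = u := fun k t h => by
    obtain ⟨u, hu⟩ := (hM.isUnit_mulRightCon_iff (e k) t).2 h
    refine ⟨u, hu, ?_⟩
    rw [← toWithZeroUnits_coe, hu]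
    rfl
  have hne : ∀ k, φ k (x k) ≠ 0 := fun k => by
    obtain ⟨u, -, h⟩ := hφ k (x k) (hx k).ge
    rw [h]
    exact WithZero.coe_ne_zero
  let ψ : ∀ k, M →* WithZero (Q k)ˣ := fun k => (powMonoidHom (c k)).comp (φ k)
  have hψ : ∀ k t, ψ k t = φ k t ^ c k := fun _ _ => rfl
  obtain ⟨Y, i1, i2, h1, h2, h3, h4⟩ := exists_not_isClosed_range
    (fun k => (ψ k : M →ₙ* WithZero (Q k)ˣ)) x
    (fun k l hkl => by
      change ψ k (x l) = 0
      rw [hψ, hφ0 k _ (by rw [hx]; exact he k l hkl), zero_pow (hc k)])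
    (fun k j => pow_ne_zero j (pow_ne_zero (c k) (hne k)))
    (fun t => (hev t).mono fun k hk => by
      change ψ k t = 0 ∨ ψ k t = 1
      by_cases h : e k ≤ hM.idemPow t
      · right
        obtain ⟨u, hu, hut⟩ := hφ k t h
        have : u ^ c k = 1 := Units.ext <| by
          rw [Units.val_pow_eq_pow_val, hu, ← map_pow]
          exact mulRightCon_eq.2 (by rw [hk h, one_mul])
        rw [hψ, hut, ← WithZero.coe_pow, this, WithZero.coe_one]
      · left
        rw [hψ, hφ0 k t h, zero_pow (hc k)])
  refine ⟨Y, i1, i2, h1, h2, fun hpow => h3 fun k j hj hjk hEq => hpow k j hj hjk ?_, h4⟩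
  change ψ k (x k) ^ j = ψ k (x k) at hEq
  obtain ⟨u, hu, hux⟩ := hφ k (x k) (hx k).ge
  rw [hψ, ← pow_mul, hux, ← WithZero.coe_pow, ← WithZero.coe_pow, WithZero.coe_inj] at hEq
  have h5 := congrArg Units.val hEq
  rw [Units.val_pow_eq_pow_val, Units.val_pow_eq_pow_val, hu, ← map_pow, ← map_pow] at h5
  exact mulRightCon_eq.1 h5

theorem exists_pow_eq_one_of_subgroup (hM : AbsolutelyT2SClosed M) (e : Idem M) :
    ∃ n, 0 < n ∧ ∀ t, e ≤ hM.idemPow t → t ^ n * e.1 = e.1 := by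
  have := (hM.quotient (mulRightCon e.1)).finite_units
  refine ⟨Nat.card (mulRightCon e.1).Quotientˣ, Nat.card_pos, fun t ht => ?_⟩
  obtain ⟨u, hu⟩ := (hM.isUnit_mulRightCon_iff e t).2 ht
  have h := congrArg Units.val (pow_card_eq_one' (x := u))
  rw [Units.val_pow_eq_pow_val, hu] at h
  have h' := mulRightCon_eq.1 (((mulRightCon e.1).mk'.map_pow t _).trans (h.trans Units.val_one))
  rwa [one_mul] at h'

open Nat in
theorem exists_pow_factorial (hM : AbsolutelyT2SClosed M) :
    ∃ k, ∀ x : M, x * (hM.idemPow x).1 = x → x ^ (k ! * k !) = (hM.idemPow x).1 := by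
  by_contra! hcon
  choose g hg hgk using hcon
  choose N hN hNt using hM.exists_pow_eq_one_of_subgroup
  have hlt : ∀ k, k < N (hM.idemPow (g k)) := fun k => by
    by_contra! hle
    refine hgk k ?_
    have h1 := pow_mul_eq_of_dvd (hNt _ (g k) le_rfl)
      ((Nat.dvd_factorial (hN _) hle).mul_right k !)
    have h2 : (k ! * k !) ≠ 0 := mul_ne_zero k.factorial_ne_zero k.factorial_ne_zero
    rwa [pow_mul_eq_self (hg k) h2] at h1
  have hinf : (range fun k => hM.idemPow (g k)).Infinite := fun hfin => by
    obtain ⟨b, hb⟩ := (hfin.image N).bddAbove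
    exact (hlt b).not_ge (hb (mem_image_of_mem N (mem_range_self b)))
  let f := hinf.natEmbedding
  choose i hi using fun n => (f n).2
  have hF : Function.Injective fun n => (f n).1 := Subtype.val_injective.comp f.injective
  have hinj : Function.Injective i := fun a b hab => hF (by simp only [← hi, hab])
  obtain ⟨s, hs⟩ := hM.exists_antichain (fun n => (f n).1) hF
  obtain ⟨r, hr, hir⟩ := strictMono_subseq_of_tendsto_atTop
    (hinj.comp s.injective).nat_tendsto_atTop
  obtain ⟨Y, _, _, _, -, hT2, h, hcl⟩ := hM.exists_not_isClosed_range_of_antichain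
    (e := fun k => (f (s (r k))).1) (x := fun k => g (i (s (r k)))) (c := fun k => k !)
    (fun k l hkl => hs _ _ (hr.injective.ne hkl)) (fun k => hi _) (fun k => k.factorial_ne_zero)
    (fun t => by
      obtain ⟨m, hm, ht⟩ := hM.exists_idemPow_eq t
      filter_upwards [eventually_ge_atTop m] with k hk hle
      refine pow_mul_eq_of_dvd (m := m) ?_ (Nat.dvd_factorial hm hk)
      rw [← ht, mul_comm]
      exact Idem.le_iff.1 hle)
  have := hT2 fun k j hj hjk heq => by
    have hk : k ≤ i (s (r k)) := hir.le_apply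
    have hu := ((hM.isUnit_mulRightCon_iff _ (g (i (s (r k))))).2 (hi (s (r k))).ge).pow (k !)
    obtain ⟨l, rfl⟩ := Nat.exists_eq_add_of_le' (one_le_two.trans hj)
    have h1 := mulRightCon_eq.2 heq
    rw [mul_add, mul_one, pow_add, Con.coe_mul] at h1
    have h2 := mulRightCon_eq.1 (hu.mul_eq_right.1 h1)
    rw [one_mul] at h2
    refine hgk (i (s (r k))) ?_
    have h3 := pow_mul_eq_of_dvd h2 (mul_dvd_mul (Nat.factorial_dvd_factorial hk)
      (Nat.dvd_factorial (by omega) (by omega : l ≤ i (s (r k)))))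
    rw [← hi, pow_mul_eq_self (hg _) (mul_ne_zero (Nat.factorial_ne_zero _)
      (Nat.factorial_ne_zero _))] at h3
    exact h3
  exact hcl (hM Y h)

open Nat in
theorem exists_pow_eq_idemPow (hM : AbsolutelyT2SClosed M) :
    ∃ n, 0 < n ∧ ∀ x, x ^ n = (hM.idemPow x).1 := by
  obtain ⟨k, hk⟩ := hM.exists_pow_factorial
  choose m hm hxm using hM.exists_idemPow_eq
  have hfin := hM.finite_not_clifford
  let P := ∏ x ∈ hfin.toFinset, m x
  have hP : 0 < P := Finset.prod_pos fun x _ => hm x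
  have hK : 0 < k ! * k ! := Nat.mul_pos k.factorial_pos k.factorial_pos
  refine ⟨P * (k ! * k !), Nat.mul_pos hP hK, fun x => ?_⟩
  by_cases hx : x * (hM.idemPow x).1 = x
  · rw [mul_comm, pow_mul, hk x hx]
    exact IsIdempotentElem.pow_eq (hM.idemPow x).2 hP.ne'
  · obtain ⟨l, hl⟩ := (Finset.dvd_prod_of_mem m (hfin.mem_toFinset.2 hx)).mul_right (k ! * k !)
    have hl0 : l ≠ 0 := by
      rintro rfl
      exact (Nat.mul_pos hP hK).ne' hl
    change x ^ (P * _) = _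
    rw [hl, pow_mul, ← hxm]
    exact IsIdempotentElem.pow_eq (hM.idemPow x).2 hl0

theorem isTame (hM : AbsolutelyT2SClosed M) : IsTame M := by
  obtain ⟨n, hn, h⟩ := hM.exists_pow_eq_idemPow
  obtain ⟨n, rfl⟩ := Nat.exists_eq_succ_of_ne_zero hn.ne'
  have hs : ∀ x, spow x n = (hM.idemPow x).1 := fun x => (spow_eq_pow x n).trans (h x)
  refine ⟨hM.wellFoundedLT, hM.wellFoundedGT, n, fun x => ?_, ?_, fun e he => ?_⟩
  · rw [hs, (hM.idemPow x).2]
  · simp only [hs, mul_comm]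
    simpa only [mul_comm] using hM.finite_not_clifford
  · refine (hM.finite_subgroup he).subset fun u hu => ⟨hu.1, u ^ n, ?_⟩
    rw [← pow_succ', ← spow_eq_pow, hu.2]

end AbsolutelyT2SClosed

theorem AbsolutelyT1SClosed.finite (h1 : AbsolutelyT1SClosed M) : Finite M := by
  have hM := h1.absolutelyT2SClosed
  have hE : Finite (Idem M) := by
    by_contra hinf
    rw [not_finite_iff_infinite] at hinf
    let f := Infinite.natEmbedding (Idem M)
    obtain ⟨s, hs⟩ := hM.exists_antichain f f.injective
    choose N hN hNt using hM.exists_pow_eq_one_of_subgroup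
    obtain ⟨Y, _, _, _, _, -, h, hcl⟩ := hM.exists_not_isClosed_range_of_antichain
      (e := fun k => f (s k)) (x := fun k => (f (s k)).1) (c := fun k => N (f (s k))) hs
      (fun k => hM.idemPow_of_idem _) (fun k => (hN _).ne')
      (fun t => Eventually.of_forall fun k => hNt _ t)
    exact hcl (h1 Y h)
  refine Set.finite_univ_iff.1 ((hM.finite_not_clifford.union
    (Set.finite_iUnion fun e : Idem M => hM.finite_subgroup e.2)).subset fun x _ => ?_)
  by_cases hx : x * (hM.idemPow x).1 = x
  · refine Or.inr (mem_iUnion.2 ⟨hM.idemPow x, hx, ?_⟩)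
    obtain ⟨n, hn, hxn⟩ := hM.exists_idemPow_eq x
    exact ⟨x ^ (n - 1), by rw [mul_pow_sub_one hn.ne', hxn]⟩
  · exact Or.inl hx

end Escaping

theorem statement2 (X : Type u) [CommSemigroup X] (S : Subsemigroup X) :
    (AbsolutelyT2SClosed X → AbsolutelyT2SClosed ↥S) ∧
    (AbsolutelyT1SClosed X → AbsolutelyT1SClosed ↥S) := by
  let f : S →ₙ* WithOne X := WithOne.coeMulHom.comp (MulMemClass.subtype S)
  have hf : Function.Injective f := WithOne.coe_injective.comp Subtype.val_injective
  refine ⟨fun hX => (hX.withOne.isTame.of_injective f hf).absolutelyT2SClosed, fun hX => ?_⟩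
  have := hX.withOne.finite
  have := Finite.of_injective f hf
  intro Y _ _ _ _ h
  exact (finite_range h).isClosed
end

section
/- If a semigroup X is absolutely T₁S-closed, then its ideal center IZ(X) is an absolutely T₁S-closed semigroup. -/
universe u

open Set TopologicalSpace

/-- If the compatible preorders `R n` on `S` decrease to a symmetric relation, then the image of an
absolutely `T₁S`-closed semigroup in `S` is closed for the topology they define, up to that
relation. -/
theorem AbsolutelyT1SClosed.exists_forall_rel {X S : Type u} [Semigroup X] [Semigroup S]
    (hX : AbsolutelyT1SClosed X) (R : ℕ → S → S → Prop) (refl : ∀ n a, R n a a)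
    (trans : ∀ n a b c, R n a b → R n b c → R n a c)
    (mul : ∀ n a b c d, R n a b → R n c d → R n (a * c) (b * d))
    (anti : ∀ m n a b, m ≤ n → R n a b → R m a b)
    (symm : ∀ a b, (∀ n, R n a b) → ∀ n, R n b a)
    (h : X →ₙ* S) (s : S) (hs : ∀ n, ∃ x, R n s (h x)) : ∃ x, ∀ n, R n s (h x) := by
  let _ : TopologicalSpace S :=
    { IsOpen := fun U => ∀ a ∈ U, ∃ n, ∀ b, R n a b → b ∈ U
      isOpen_univ := fun _ _ => ⟨0, fun _ _ => mem_univ _⟩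
      isOpen_inter := by
        rintro U V hU hV a ⟨haU, haV⟩
        obtain ⟨m, hm⟩ := hU a haU
        obtain ⟨n, hn⟩ := hV a haV
        exact ⟨max m n, fun b hb => ⟨hm b (anti _ _ _ _ (le_max_left _ _) hb),
          hn b (anti _ _ _ _ (le_max_right _ _) hb)⟩⟩
      isOpen_sUnion := by
        rintro F hF a ⟨U, hU, haU⟩
        obtain ⟨n, hn⟩ := hF U hU a haU
        exact ⟨n, fun b hb => ⟨U, hU, hn b hb⟩⟩ }
  have isOpen_def : ∀ U : Set S, IsOpen U ↔ ∀ a ∈ U, ∃ n, ∀ b, R n a b → b ∈ U := fun _ => Iff.rfl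
  have isOpen_rel : ∀ n a, IsOpen {b | R n a b} := fun n a =>
    (isOpen_def _).2 fun b hb => ⟨n, fun c hc => trans _ _ _ _ hb hc⟩
  have specializes_iff : ∀ a b : S, b ⤳ a ↔ ∀ n, R n a b := by
    intro a b
    rw [specializes_iff_forall_open]
    refine ⟨fun H n => H _ (isOpen_rel n a) (refl n a), fun H U hU ha => ?_⟩
    obtain ⟨n, hn⟩ := (isOpen_def U).1 hU a ha
    exact hn b (H n)
  have : ContinuousMul S := by
    refine ⟨continuous_def.2 fun U hU => isOpen_iff_mem_nhds.2 ?_⟩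
    rintro ⟨a, c⟩ hac
    obtain ⟨n, hn⟩ := (isOpen_def U).1 hU _ hac
    filter_upwards [prod_mem_nhds ((isOpen_rel n a).mem_nhds (refl n a))
      ((isOpen_rel n c).mem_nhds (refl n c))]
    rintro ⟨b, d⟩ ⟨hb, hd⟩
    exact hn _ (mul _ _ _ _ _ hb hd)
  have : R0Space S :=
    ⟨⟨fun a b hab => (specializes_iff _ _).2 (symm _ _ ((specializes_iff _ _).1 hab))⟩⟩
  have : T1Space (SeparationQuotient S) := SeparationQuotient.t1Space_iff.2 inferInstance
  let k : X →ₙ* SeparationQuotient S :=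
    { toFun := fun x => SeparationQuotient.mk (h x)
      map_mul' := fun x y => by rw [map_mul]; rfl }
  have hclosed := (hX _ k).preimage SeparationQuotient.continuous_mk
  have hmem : s ∈ SeparationQuotient.mk ⁻¹' range k := by
    by_contra hns
    obtain ⟨n, hn⟩ := (isOpen_def _).1 hclosed.isOpen_compl s hns
    obtain ⟨x, hx⟩ := hs n
    exact hn _ hx ⟨x, rfl⟩
  obtain ⟨x, hx⟩ := hmem
  exact ⟨x, (specializes_iff _ _).1 (SeparationQuotient.mk_eq_mk.1 hx).specializes⟩

/-- A version of `AbsolutelyT1SClosed.exists_forall_rel` for preorders decreasing to equality. -/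
theorem AbsolutelyT1SClosed.mem_range_of_rel {X S : Type u} [Semigroup X] [Semigroup S]
    (hX : AbsolutelyT1SClosed X) (R : ℕ → S → S → Prop) (refl : ∀ n a, R n a a)
    (trans : ∀ n a b c, R n a b → R n b c → R n a c)
    (mul : ∀ n a b c d, R n a b → R n c d → R n (a * c) (b * d))
    (anti : ∀ m n a b, m ≤ n → R n a b → R m a b) (eq : ∀ a b, (∀ n, R n a b) → a = b)
    (h : X →ₙ* S) (s : S) (hs : ∀ n, ∃ x, R n s (h x)) : s ∈ range h := by
  obtain ⟨x, hx⟩ := hX.exists_forall_rel R refl trans mul anti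
    (fun a b H n => eq a b H ▸ refl n a) h s hs
  exact ⟨x, (eq _ _ hx).symm⟩

/-- The `𝒥`-preorder of a semigroup: every ideal containing `b` contains `a`. -/
def JLe {X : Type*} [Semigroup X] (a b : X) : Prop :=
  ∀ I : Set X, IsIdealSet X I → b ∈ I → a ∈ I

theorem JLe.refl {X : Type*} [Semigroup X] (a : X) : JLe a a := fun _ _ h => h

theorem JLe.trans {X : Type*} [Semigroup X] {a b c : X} (hab : JLe a b) (hbc : JLe b c) :
    JLe a c := fun I hI h => hab I hI (hbc I hI h)

theorem JLe.mul_right {X : Type*} [Semigroup X] (a x : X) : JLe (a * x) a :=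
  fun _ hI h => (hI a h x).1

theorem JLe.mul_left {X : Type*} [Semigroup X] (x a : X) : JLe (x * a) a :=
  fun _ hI h => (hI a h x).2

/-- The semigroup `X` with an external zero and a further point `pt` adjoined, every product
involving `pt` being zero. -/
inductive AdjoinNull (X : Type u) : Type u
  | of (x : X)
  | zero
  | pt

namespace AdjoinNull

instance {X : Type u} [Semigroup X] : Semigroup (AdjoinNull X) where
  mul
    | of x, of y => of (x * y)
    | _, _ => zero
  mul_assoc a b c := by
    cases a <;> cases b <;> cases c <;> first | rfl | exact congrArg of (mul_assoc _ _ _)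

/-- `insertZero J` is the set `J` together with the adjoined zero. -/
def insertZero {X : Type u} (J : Set X) : Set (AdjoinNull X) := insert zero (of '' J)

theorem mul_mem_insertZero {X : Type u} [Semigroup X] {J : Set X} (hJ : IsIdealSet X J)
    {a : AdjoinNull X} (ha : a ∈ insertZero J) (b : AdjoinNull X) :
    a * b ∈ insertZero J ∧ b * a ∈ insertZero J := by
  rcases ha with rfl | ⟨x, hx, rfl⟩
  · cases b <;> exact ⟨Or.inl rfl, Or.inl rfl⟩
  · cases b with
    | of y => exact ⟨Or.inr ⟨_, (hJ x hx y).1, rfl⟩, Or.inr ⟨_, (hJ x hx y).2, rfl⟩⟩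
    | zero => exact ⟨Or.inl rfl, Or.inl rfl⟩
    | pt => exact ⟨Or.inl rfl, Or.inl rfl⟩

end AdjoinNull

open AdjoinNull in
/-- Outside an ideal `J` of an absolutely `T₁S`-closed semigroup, no sequence has the property
that each element outside `J` is below only finitely many of its terms. -/
theorem AbsolutelyT1SClosed.exists_notMem_frequently_jLe {X : Type u} [Semigroup X]
    (hX : AbsolutelyT1SClosed X) {J : Set X} (hJ : IsIdealSet X J) (z : ℕ → X)
    (hz : ∀ n, z n ∉ J) : ∃ y ∉ J, ∀ n, ∃ m ≥ n, JLe y (z m) := by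
  by_contra! H
  let I : ℕ → Set X := fun n => {y | y ∈ J ∨ ∃ m ≥ n, JLe y (z m)}
  have hI : ∀ n, IsIdealSet X (I n) := by
    rintro n x (hx | ⟨m, hm, hx⟩) y
    · exact ⟨Or.inl (hJ x hx y).1, Or.inl (hJ x hx y).2⟩
    · exact ⟨Or.inr ⟨m, hm, (JLe.mul_right x y).trans hx⟩,
        Or.inr ⟨m, hm, (JLe.mul_left y x).trans hx⟩⟩
  have hJI : ∀ n, insertZero J ⊆ insertZero (I n) := by
    rintro n _ (rfl | ⟨x, hx, rfl⟩)
    exacts [Or.inl rfl, Or.inr ⟨x, Or.inl hx, rfl⟩]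
  have hzI : ∀ n m, n ≤ m → of (z m) ∈ insertZero (I n) :=
    fun n m hnm => Or.inr ⟨_, Or.inr ⟨m, hnm, JLe.refl _⟩, rfl⟩
  have hinter : ∀ a, (∀ n, a ∈ insertZero (I n)) → a ∈ insertZero J := by
    intro a ha
    cases a with
    | zero => exact Or.inl rfl
    | pt => rcases ha 0 with h | ⟨_, _, h⟩ <;> cases h
    | of x =>
      by_contra hx
      have hxJ : x ∉ J := fun h => hx (Or.inr ⟨x, h, rfl⟩)
      obtain ⟨n, hn⟩ := H x hxJ
      rcases ha n with h | ⟨y, hy, h⟩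
      · cases h
      · cases h
        rcases hy with hy | ⟨m, hm, hy⟩
        exacts [hxJ hy, hn m hm hy]
  let R : ℕ → AdjoinNull X → AdjoinNull X → Prop := fun n a b =>
    a = b ∨ (a ∈ insertZero J ∧ b ∈ insertZero (I n)) ∨ (a = pt ∧ ∃ m ≥ n, b = of (z m))
  have hRmem : ∀ n a b, a ∈ insertZero J → R n a b → b ∈ insertZero (I n) := by
    rintro n a b ha (rfl | ⟨_, hb⟩ | ⟨rfl, -⟩)
    · exact hJI n ha
    · exact hb
    · rcases ha with h | ⟨_, _, h⟩ <;> cases h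
  have hpt : ∀ c : AdjoinNull X, pt * c ∈ insertZero J ∧ c * pt ∈ insertZero J := by
    intro c
    cases c <;> exact ⟨Or.inl rfl, Or.inl rfl⟩
  have hR : ∀ n a b, a ∈ insertZero J → b ∈ insertZero (I n) → R n a b :=
    fun n a b ha hb => Or.inr (Or.inl ⟨ha, hb⟩)
  have trans : ∀ n a b c, R n a b → R n b c → R n a c := by
    rintro n a b c (rfl | ⟨ha, hb⟩ | ⟨rfl, m, hm, rfl⟩) hbc
    · exact hbc
    · rcases hbc with rfl | ⟨_, hc⟩ | ⟨rfl, -⟩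
      · exact hR n _ _ ha hb
      · exact hR n _ _ ha hc
      · rcases hb with h | ⟨_, _, h⟩ <;> cases h
    · rcases hbc with rfl | ⟨hb, -⟩ | ⟨h, -⟩
      · exact Or.inr (Or.inr ⟨rfl, m, hm, rfl⟩)
      · rcases hb with h | ⟨x, hx, h⟩
        · cases h
        · cases h
          exact absurd hx (hz m)
      · cases h
  have mul_right : ∀ n a b c, R n a b → R n (a * c) (b * c) ∧ R n (c * a) (c * b) := by
    rintro n a b c (rfl | ⟨ha, hb⟩ | ⟨rfl, m, hm, rfl⟩)
    · exact ⟨Or.inl rfl, Or.inl rfl⟩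
    · exact ⟨hR _ _ _ (mul_mem_insertZero hJ ha c).1 (mul_mem_insertZero (hI n) hb c).1,
        hR _ _ _ (mul_mem_insertZero hJ ha c).2 (mul_mem_insertZero (hI n) hb c).2⟩
    · exact ⟨hR _ _ _ (hpt c).1 (mul_mem_insertZero (hI n) (hzI n m hm) c).1,
        hR _ _ _ (hpt c).2 (mul_mem_insertZero (hI n) (hzI n m hm) c).2⟩
  have hof : ∀ x, ¬ ∀ n, R n pt (of x) := by
    intro x hx
    have hx' : ∀ n, ∃ m ≥ n, x = z m := by
      intro n
      rcases hx n with h | ⟨h, -⟩ | ⟨-, m, hm, h⟩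
      · cases h
      · rcases h with h | ⟨_, _, h⟩ <;> cases h
      · cases h
        exact ⟨m, hm, rfl⟩
    obtain ⟨m, -, hm⟩ := hx' 0
    obtain ⟨n, hn⟩ := H x (hm ▸ hz m)
    obtain ⟨k, hk, rfl⟩ := hx' n
    exact hn k hk (JLe.refl _)
  have symm : ∀ a b, (∀ n, R n a b) → ∀ n, R n b a := by
    intro a b hab n
    by_cases ha : a ∈ insertZero J
    · exact hR n b a (hinter b fun k => hRmem k a b ha (hab k)) (hJI n ha)
    · rcases hab 0 with rfl | ⟨ha', -⟩ | ⟨rfl, m, -, rfl⟩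
      · exact Or.inl rfl
      · exact absurd ha' ha
      · exact absurd hab (hof _)
  obtain ⟨x, hx⟩ := hX.exists_forall_rel R (fun _ _ => Or.inl rfl) trans
    (fun n a b c d hab hcd => trans _ _ _ _ (mul_right n a b c hab).1 (mul_right n c d b hcd).2)
    (by
      rintro m n a b hmn (rfl | ⟨ha, hb⟩ | ⟨rfl, k, hk, rfl⟩)
      · exact Or.inl rfl
      · refine hR _ _ _ ha ?_
        rcases hb with rfl | ⟨x, hx | ⟨k, hk, hx⟩, rfl⟩
        · exact Or.inl rfl
        · exact Or.inr ⟨x, Or.inl hx, rfl⟩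
        · exact Or.inr ⟨x, Or.inr ⟨k, hmn.trans hk, hx⟩, rfl⟩
      · exact Or.inr (Or.inr ⟨rfl, k, hmn.trans hk, rfl⟩))
    symm ⟨of, fun _ _ => rfl⟩ pt (fun n => ⟨z n, Or.inr (Or.inr ⟨rfl, n, le_rfl, rfl⟩)⟩)
  exact hof x hx

theorem AbsolutelyT1SClosed.wellQuasiOrdered_jLe {X : Type u} [Semigroup X]
    (hX : AbsolutelyT1SClosed X) : WellQuasiOrdered (JLe : X → X → Prop) := by
  intro z
  have hJ : IsIdealSet X {x | ∀ n, ¬ JLe (z n) x} := fun x hx y =>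
    ⟨fun n h => hx n (h.trans (JLe.mul_right x y)), fun n h => hx n (h.trans (JLe.mul_left y x))⟩
  obtain ⟨y, hy, hyz⟩ := hX.exists_notMem_frequently_jLe hJ z fun n h => h n (JLe.refl _)
  simp only [mem_ofPred_eq, not_forall, not_not] at hy
  obtain ⟨m, hm⟩ := hy
  obtain ⟨n, hn, h⟩ := hyz (m + 1)
  exact ⟨m, n, hn, hm.trans h⟩

open Classical in
/-- A sequence of sets with the property that a product is in `T k` if and only if both factors
are cannot be exhausted from below by elements that miss some `T k`. -/
theorem AbsolutelyT1SClosed.exists_forall_mem_imp {X : Type u} [Semigroup X]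
    (hX : AbsolutelyT1SClosed X) (T : ℕ → Set X)
    (hT : ∀ k x y, x * y ∈ T k ↔ x ∈ T k ∧ y ∈ T k) :
    ∃ n, ∀ x, (∀ k < n, x ∈ T k) → ∀ k, x ∈ T k := by
  by_contra! H
  let f : X →ₙ* ULift.{u} ((ℕ → ℕ) × ℕ) :=
    { toFun := fun x => ⟨fun k => if x ∈ T k then 1 else 0, if ∀ k, x ∈ T k then 1 else 0⟩
      map_mul' := by
        intro x y
        refine ULift.ext _ _ (Prod.ext (funext fun k => ?_) ?_)
        · by_cases hx : x ∈ T k <;> by_cases hy : y ∈ T k <;> simp [hT, hx, hy]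
        · by_cases hx : ∀ k, x ∈ T k <;> by_cases hy : ∀ k, y ∈ T k <;>
            simp [hT, forall_and, hx, hy] }
  obtain ⟨x, hx⟩ := hX.mem_range_of_rel
    (fun n (a b : ULift.{u} ((ℕ → ℕ) × ℕ)) => a.down.2 = b.down.2 ∧ ∀ k < n, a.down.1 k = b.down.1 k)
    (fun _ _ => ⟨rfl, fun _ _ => rfl⟩)
    (fun _ _ _ _ h h' => ⟨h.1.trans h'.1, fun k hk => (h.2 k hk).trans (h'.2 k hk)⟩)
    (fun _ _ _ _ _ h h' =>
      ⟨congrArg₂ (· * ·) h.1 h'.1, fun k hk => congrArg₂ (· * ·) (h.2 k hk) (h'.2 k hk)⟩)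
    (fun _ _ _ _ hmn h => ⟨h.1, fun k hk => h.2 k (hk.trans_le hmn)⟩)
    (fun _ _ h => ULift.ext _ _ (Prod.ext (funext fun k => (h (k + 1)).2 k k.lt_succ_self) (h 0).1))
    f ⟨fun _ => 1, 0⟩ (fun n => by
      obtain ⟨x, hx, k, hk⟩ := H n
      refine ⟨x, ?_, fun k hk => ?_⟩
      · simp only [f, MulHom.coe_mk]
        rw [if_neg (fun h => hk (h k))]
      · simp [f, hx k hk])
  have h1 : ∀ k, x ∈ T k := by
    intro k
    by_contra hk
    have := congrFun (congrArg (fun a => a.down.1) hx) k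
    simp [f, hk] at this
  have := congrArg (fun a => a.down.2) hx
  simp [f, h1] at this

/-- The `ℛ`-preorder of a semigroup. -/
def RLe {X : Type*} [Semigroup X] (a b : X) : Prop := a = b ∨ ∃ x, a = b * x

theorem RLe.refl {X : Type*} [Semigroup X] (a : X) : RLe a a := Or.inl rfl

theorem RLe.trans {X : Type*} [Semigroup X] {a b c : X} (hab : RLe a b) (hbc : RLe b c) :
    RLe a c := by
  rcases hab with rfl | ⟨x, rfl⟩
  · exact hbc
  · rcases hbc with rfl | ⟨y, rfl⟩
    exacts [Or.inr ⟨x, rfl⟩, Or.inr ⟨y * x, mul_assoc _ _ _⟩]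

theorem RLe.mul_right {X : Type*} [Semigroup X] (a x : X) : RLe (a * x) a := Or.inr ⟨x, rfl⟩

instance {X : Type*} [Semigroup X] : IsPreorder X RLe where
  refl := RLe.refl
  trans _ _ _ := RLe.trans

section IdealCenter

variable {X : Type u} [Semigroup X] {z : X}

theorem mul_right_comm_of_mem_idealCenter (hz : z ∈ idealCenter X) (x y : X) :
    z * x * y = z * y * x := by
  rw [hz.2 x y, ← mul_assoc, ← hz.1 y]

theorem mul_mem_idealCenter (hz : z ∈ idealCenter X) (x : X) : z * x ∈ idealCenter X :=
  ⟨hz.2 x, fun y => mul_assoc z x y ▸ hz.2 (x * y)⟩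

theorem RLe.mul_of_mem_idealCenter {a : X} (hz : z ∈ idealCenter X) (h : RLe a z) (x : X) :
    RLe (a * x) (z * x) := by
  rcases h with rfl | ⟨y, rfl⟩
  · exact RLe.refl _
  · rw [mul_right_comm_of_mem_idealCenter hz]
    exact RLe.mul_right _ _

theorem JLe.rLe {a : X} (h : JLe a z) (hz : z ∈ idealCenter X) : RLe a z := by
  refine h {y | RLe y z} (fun y hy x => ⟨(RLe.mul_right y x).trans hy, ?_⟩) (RLe.refl z)
  rcases hy with rfl | ⟨w, rfl⟩
  · exact Or.inr ⟨x, (hz.1 x).symm⟩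
  · exact Or.inr ⟨x * w, by rw [← mul_assoc, ← hz.1 x, mul_assoc]⟩

theorem JLe.rLe_mul_left {a b : X} (h : JLe a b) (hz : z ∈ idealCenter X) :
    RLe (z * a) (z * b) := by
  refine h {y | RLe (z * y) (z * b)} (fun y hy x => ⟨?_, ?_⟩) (RLe.refl _)
  · rw [mem_ofPred_eq, ← mul_assoc]
    exact (RLe.mul_right _ _).trans hy
  · rw [mem_ofPred_eq, ← mul_assoc, mul_right_comm_of_mem_idealCenter hz]
    exact (RLe.mul_right _ _).trans hy

theorem rLe_mul_mul_iff (hz : z ∈ idealCenter X) (x y : X) :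
    RLe z (z * (x * y)) ↔ RLe z (z * x) ∧ RLe z (z * y) := by
  rw [← mul_assoc]
  refine ⟨fun h => ⟨h.trans (RLe.mul_right _ _), ?_⟩, fun ⟨hx, hy⟩ => hy.trans ?_⟩
  · rw [mul_right_comm_of_mem_idealCenter hz] at h
    exact h.trans (RLe.mul_right _ _)
  · exact hx.mul_of_mem_idealCenter (mul_mem_idealCenter hz x) y

/-- The ideal center of an absolutely `T₁S`-closed semigroup has no strictly ascending sequences
with respect to divisibility. -/
theorem AbsolutelyT1SClosed.exists_rLe_succ (hX : AbsolutelyT1SClosed X) (z : ℕ → X)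
    (hz : ∀ n, z n ∈ idealCenter X) (hmono : ∀ n, RLe (z n) (z (n + 1))) :
    ∃ n, RLe (z (n + 1)) (z n) := by
  by_contra! H
  have hx : ∀ n, ∃ x, z n = z (n + 1) * x := fun n =>
    (hmono n).resolve_left fun h => H n (h ▸ RLe.refl _)
  choose x hx using hx
  let T : ℕ → Set X := fun k => {y | RLe (z k) (z k * y)}
  have hanti : Antitone T := by
    refine antitone_nat_of_succ_le fun k y hy => ?_
    have := RLe.mul_of_mem_idealCenter (mul_mem_idealCenter (hz (k + 1)) y) hy (x k)
    rwa [mul_right_comm_of_mem_idealCenter (hz _), ← hx] at this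
  obtain ⟨k, hk⟩ := hX.exists_forall_mem_imp T fun k => rLe_mul_mul_iff (hz k)
  let p : ℕ → X := Nat.rec (x k) fun n q => x (k + n + 1) * q
  have hp : ∀ n, z (k + n + 1) * p n = z k := by
    intro n
    induction n with
    | zero => exact (hx k).symm
    | succ n ih =>
      change z (k + n + 1 + 1) * (x (k + n + 1) * p n) = _
      rw [← mul_assoc, ← hx, ih]
  obtain ⟨m, n, hmn, hle⟩ := hX.wellQuasiOrdered_jLe p
  have hstep : ∀ j, m + 1 ≤ j → RLe (z (k + m + 1) * p j) (z k * x (k + m + 1)) := by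
    intro j hj
    induction j, hj using Nat.le_induction with
    | base =>
      change RLe (z (k + m + 1) * (x (k + m + 1) * p m)) _
      rw [← mul_assoc, mul_right_comm_of_mem_idealCenter (hz _), hp]
      exact RLe.refl _
    | succ j hj ih =>
      change RLe (z (k + m + 1) * (x (k + j + 1) * p j)) _
      rw [← mul_assoc, mul_right_comm_of_mem_idealCenter (hz _)]
      exact (RLe.mul_right _ _).trans ih
  have hmem : x (k + m + 1) ∈ T k := by
    have := hle.rLe_mul_left (hz (k + m + 1))
    rw [hp] at this
    exact this.trans (hstep n hmn)
  have := hk (x (k + m + 1)) (fun j hj => hanti hj.le hmem) (k + m + 1 + 1)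
  refine H (k + m + 1) ?_
  rw [hx (k + m + 1)]
  exact this

end IdealCenter

section Groups

variable {X G : Type u} [Semigroup X] [CommGroup G]

/-- The limit of a sequence in `G` with the stated independence property can be adjoined to `G`
with an `N`-th power in `G`, where `N = 0` means that no power of it is in `G`. -/
theorem AbsolutelyT1SClosed.false_of_sequence (hX : AbsolutelyT1SClosed X) (f : X →ₙ* WithZero G)
    (hf : ∀ g : G, ∃ x, f x = g) {N : ℕ} (hN : N ≠ 1) (g : ℕ → G)
    (hg : ∀ (y : G) (c : ZMod N), (∀ n, ∃ s : Multiset ℕ, (∀ i ∈ s, n ≤ i) ∧ (s.map g).prod = y ∧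
      (s.card : ZMod N) = c) → y = 1 ∧ c = 0) : False := by
  let t : Multiplicative (ZMod N) := Multiplicative.ofAdd 1
  let P : ℕ → Submonoid (G × Multiplicative (ZMod N)) := fun n =>
    Submonoid.closure ((fun i => (g i, t)) '' Ici n)
  have hanti : ∀ m n, m ≤ n → P n ≤ P m := fun m n hmn =>
    Submonoid.closure_mono (image_mono (Ici_subset_Ici.2 hmn))
  have hP : ∀ n, ∀ u ∈ P n, ∃ s : Multiset ℕ, (∀ i ∈ s, n ≤ i) ∧ (s.map g).prod = u.1 ∧
      (s.card : ZMod N) = u.2.toAdd := by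
    intro n u hu
    induction hu using Submonoid.closure_induction with
    | mem u hu =>
      obtain ⟨i, hi, rfl⟩ := hu
      exact ⟨{i}, by simpa using hi, by simp, by simp [t]⟩
    | one => exact ⟨0, by simp, by simp, by simp⟩
    | mul u v _ _ hu hv =>
      obtain ⟨s, hs, hs1, hs2⟩ := hu
      obtain ⟨r, hr, hr1, hr2⟩ := hv
      refine ⟨s + r, fun i hi => ?_, by simp [hs1, hr1], by simp [hs2, hr2]⟩
      rcases Multiset.mem_add.1 hi with hi | hi
      exacts [hs i hi, hr i hi]
  have htriv : ∀ u, (∀ n, u ∈ P n) → u = 1 := by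
    intro u hu
    obtain ⟨h1, h2⟩ := hg u.1 u.2.toAdd fun n => hP n u (hu n)
    exact Prod.ext h1 (Multiplicative.toAdd.injective h2)
  let e : WithZero G →* WithZero (G × Multiplicative (ZMod N)) :=
    (WithZero.map' (MonoidHom.inl G (Multiplicative (ZMod N)))).toMonoidHom
  have he : ∀ a : G, e a = ((a, 1) : G × Multiplicative (ZMod N)) := fun _ => rfl
  let h : X →ₙ* WithZero (G × Multiplicative (ZMod N)) := e.toMulHom.comp f
  have hh : ∀ x, h x = e (f x) := fun _ => rfl
  obtain ⟨x, hx⟩ := hX.mem_range_of_rel (S := WithZero (G × Multiplicative (ZMod N)))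
    (fun n a b => ∃ u ∈ P n, b = a * (u : WithZero (G × Multiplicative (ZMod N))))
    (fun n a => ⟨1, one_mem _, by simp⟩)
    (by
      rintro n a b c ⟨u, hu, rfl⟩ ⟨v, hv, rfl⟩
      exact ⟨u * v, mul_mem hu hv, by rw [WithZero.coe_mul, mul_assoc]⟩)
    (by
      rintro n a b c d ⟨u, hu, rfl⟩ ⟨v, hv, rfl⟩
      exact ⟨u * v, mul_mem hu hv, by rw [WithZero.coe_mul, mul_mul_mul_comm]⟩)
    (fun m n a b hmn ⟨u, hu, h⟩ => ⟨u, hanti m n hmn hu, h⟩)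
    (by
      intro a b hab
      obtain ⟨u, -, rfl⟩ := hab 0
      rcases eq_or_ne a 0 with rfl | ha
      · simp
      · have hu : ∀ n, u ∈ P n := by
          intro n
          obtain ⟨v, hv, h⟩ := hab n
          rwa [WithZero.coe_inj.1 (mul_left_cancel₀ ha h)]
        simp [htriv u hu])
    h (((1, t⁻¹) : G × Multiplicative (ZMod N)) : WithZero (G × Multiplicative (ZMod N)))
    (by
      intro n
      obtain ⟨x, hx⟩ := hf (g n)
      refine ⟨x, (g n, t), Submonoid.subset_closure ⟨n, mem_Ici.2 le_rfl, rfl⟩, ?_⟩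
      rw [hh, hx, he, ← WithZero.coe_mul]
      simp)
  rw [hh] at hx
  rcases h0 : f x with _ | a
  · rw [h0] at hx
    exact absurd hx.symm WithZero.coe_ne_zero
  · rw [h0] at hx
    have h1 := congrArg Prod.snd (WithZero.coe_inj.1 ((he a).symm.trans hx))
    have h2 : (1 : ZMod N) = 0 := by
      have := congrArg Multiplicative.toAdd h1
      simpa [t] using this
    have : Nontrivial (ZMod N) := ZMod.nontrivial_iff.2 hN
    exact one_ne_zero h2

theorem AbsolutelyT1SClosed.isOfFinOrder (hX : AbsolutelyT1SClosed X) (f : X →ₙ* WithZero G)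
    (hf : ∀ g : G, ∃ x, f x = g) (g : G) : IsOfFinOrder g := by
  by_contra hg
  have hinj := injective_pow_iff_not_isOfFinOrder.2 hg
  refine hX.false_of_sequence f hf zero_ne_one (fun n => g ^ n) fun y c H => ?_
  have hprod : ∀ s : Multiset ℕ, (s.map fun n => g ^ n).prod = g ^ s.sum := by
    intro s
    induction s using Multiset.induction with
    | empty => simp
    | cons a s ih => simp [ih, pow_add]
  obtain ⟨s, -, hs, -⟩ := H 0
  obtain ⟨r, hr, hr1, hr2⟩ := H (s.sum + 1)
  have hsum : r.sum = s.sum := hinj (by simp only [← hprod, hr1, hs])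
  obtain rfl : r = 0 := by
    refine Multiset.eq_zero_of_forall_notMem fun i hi => ?_
    have := hr i hi
    have := Multiset.le_sum_of_mem hi
    omega
  exact ⟨by simpa using hr1.symm, by simpa using hr2.symm⟩

theorem Multiset.prod_eq_one_of_independent (H : ℕ → Subgroup G) (hH : Monotone H) (g : ℕ → G)
    (hgH : ∀ n, g n ∈ H (n + 1)) {N M : ℕ}
    (hg : ∀ m c, (N = 0 → c ≤ m) → g m ^ c ∈ H m → N ∣ c ∧ g m ^ c = 1) (s : Multiset ℕ)
    (hs : ∀ i ∈ s, M ≤ i) (hcard : N = 0 → s.card ≤ M) (hprod : (s.map g).prod ∈ H M) :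
    N ∣ s.card ∧ (s.map g).prod = 1 := by
  induction hk : s.card using Nat.strong_induction_on generalizing s with
  | _ k ih =>
  rcases s.empty_or_exists_mem with rfl | ⟨i, hi⟩
  · subst hk
    simp
  · obtain ⟨m, hm, hmax⟩ := s.toFinset.exists_max_image id ⟨i, Multiset.mem_toFinset.2 hi⟩
    rw [Multiset.mem_toFinset] at hm
    have hdecomp := Multiset.filter_add_not (· = m) s
    set r := s.filter (fun a => ¬ a = m) with hr
    rw [Multiset.filter_eq'] at hdecomp
    set c := s.count m with hc
    have hcpos : 0 < c := Multiset.count_pos.2 hm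
    have hcards : c + r.card = s.card := by rw [← hdecomp]; simp
    have hprods : g m ^ c * (r.map g).prod = (s.map g).prod := by rw [← hdecomp]; simp
    have hrH : (r.map g).prod ∈ H m := by
      refine Subgroup.multiset_prod_mem _ _ fun a ha => ?_
      obtain ⟨j, hj, rfl⟩ := Multiset.mem_map.1 ha
      obtain ⟨hj, hjm⟩ := Multiset.mem_filter.1 hj
      have : j ≤ m := hmax j (Multiset.mem_toFinset.2 hj)
      exact hH (by omega : j + 1 ≤ m) (hgH j)
    obtain ⟨hNc, hgc⟩ := hg m c (fun h => by have := hcard h; have := hs m hm; omega) (by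
      rw [← Subgroup.mul_mem_cancel_right _ hrH, hprods]
      exact hH (hs m hm) hprod)
    rw [hgc, one_mul] at hprods
    obtain ⟨h1, h2⟩ := ih r.card (by omega) r (fun j hj => hs j (Multiset.mem_filter.1 hj).1)
      (fun h => by have := hcard h; omega) (hprods ▸ hprod) rfl
    exact ⟨by rw [← hk, ← hcards]; exact dvd_add hNc h1, hprods ▸ h2⟩

theorem AbsolutelyT1SClosed.false_of_forall_finset (hX : AbsolutelyT1SClosed X)
    (f : X →ₙ* WithZero G) (hf : ∀ g : G, ∃ x, f x = g) {N : ℕ} (hN : N ≠ 1)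
    (H : ∀ (A : Finset G) (m : ℕ), ∃ g : G, ∀ c, (N = 0 → c ≤ m) →
      g ^ c ∈ Subgroup.closure (A : Set G) → N ∣ c ∧ g ^ c = 1) : False := by
  classical
  choose F hF using H
  obtain ⟨A, hA⟩ : ∃ A : ℕ → Finset G, ∀ m, A (m + 1) = insert (F (A m) m) (A m) :=
    ⟨Nat.rec ∅ fun m B => insert (F B m) B, fun _ => rfl⟩
  have hmono : Monotone fun m => Subgroup.closure (A m : Set G) := by
    refine monotone_nat_of_le_succ fun m => Subgroup.closure_mono ?_
    rw [hA]
    exact Finset.coe_subset.2 (Finset.subset_insert _ _)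
  have hmem : ∀ m, F (A m) m ∈ Subgroup.closure (A (m + 1) : Set G) := fun m =>
    Subgroup.subset_closure (by simp [hA])
  refine hX.false_of_sequence f hf hN (fun m => F (A m) m) fun y c hyc => ?_
  obtain ⟨s, -, hs1, hs2⟩ := hyc 0
  have hy : ∃ M, y ∈ Subgroup.closure (A M : Set G) := by
    rw [← hs1]
    clear hs1 hs2
    induction s using Multiset.induction with
    | empty => exact ⟨0, by simp⟩
    | cons i s ih =>
      obtain ⟨M, hM⟩ := ih
      refine ⟨max M (i + 1), ?_⟩
      rw [Multiset.map_cons, Multiset.prod_cons]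
      exact mul_mem (hmono (le_max_right _ _) (hmem i)) (hmono (le_max_left _ _) hM)
  obtain ⟨M, hM⟩ := hy
  obtain ⟨r, hr, hr1, hr2⟩ := hyc (max M s.card)
  obtain ⟨h1, h2⟩ := Multiset.prod_eq_one_of_independent (N := N) _ hmono _ hmem
    (fun m => hF (A m) m) r hr (by
      rintro rfl
      have : (r.card : ℤ) = s.card := hr2.trans hs2.symm
      have := le_max_right M s.card
      omega) (by rw [hr1]; exact hmono (le_max_left _ _) hM)
  exact ⟨hr1 ▸ h2, by rw [← hr2]; exact (ZMod.natCast_eq_zero_iff _ _).2 h1⟩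

theorem finite_setOf_pow_eq_one (h : ∀ p : ℕ, p.Prime → {g : G | g ^ p = 1}.Finite) (n : ℕ)
    (hn : n ≠ 0) : {g : G | g ^ n = 1}.Finite := by
  induction n using Nat.recOnMul with
  | zero => exact absurd rfl hn
  | one => simp
  | prime p hp => exact h p hp
  | mul a b iha ihb =>
    have ha := iha (left_ne_zero_of_mul hn)
    have hb := ihb (right_ne_zero_of_mul hn)
    have hfib : ∀ y ∈ {g : G | g ^ b = 1}, ((fun g : G => g ^ a) ⁻¹' {y}).Finite := by
      intro y _
      rcases ((fun g : G => g ^ a) ⁻¹' {y}).eq_empty_or_nonempty with h | ⟨g₀, hg₀⟩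
      · simp [h]
      · refine (ha.image (fun g => g₀ * g)).subset fun g hg => ⟨g₀⁻¹ * g, ?_, by simp⟩
        have h1 : g₀ ^ a = y := hg₀
        have h2 : g ^ a = y := hg
        simp [mul_pow, h1, h2]
    refine (Set.Finite.preimage' hb hfib).subset fun g hg => ?_
    simpa [pow_mul] using hg

/-- An abelian group that, possibly with a zero adjoined, is an image of an absolutely
`T₁S`-closed semigroup is finite. -/
theorem AbsolutelyT1SClosed.finite_group (hX : AbsolutelyT1SClosed X) (f : X →ₙ* WithZero G)
    (hf : ∀ g : G, ∃ x, f x = g) : Finite G := by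
  have htors := hX.isOfFinOrder f hf
  have hfin : ∀ A : Finset G, Finite (Subgroup.closure (A : Set G)) := fun A =>
    CommGroup.finite_of_fg_isMulTorsion _ fun x => Submonoid.isOfFinOrder_coe.1 (htors x)
  by_contra hinf
  by_cases hp : ∀ p : ℕ, p.Prime → {g : G | g ^ p = 1}.Finite
  · refine hX.false_of_forall_finset f hf zero_ne_one fun A m => ?_
    have := hfin A
    by_contra! hA
    set h := Nat.card (Subgroup.closure (A : Set G))
    have hh : h ≠ 0 := Nat.card_pos.ne'
    refine hinf (finite_univ_iff.1 ((finite_setOf_pow_eq_one hp (m.factorial * h)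
      (mul_ne_zero m.factorial_ne_zero hh)).subset fun g _ => ?_))
    obtain ⟨c, hcm, hgc, hc⟩ := hA g
    have hc0 : c ≠ 0 := by
      rintro rfl
      exact hc (dvd_refl 0) (pow_zero g)
    have hpow : (g ^ c) ^ h = 1 := congrArg Subtype.val
      (pow_card_eq_one' (x := (⟨g ^ c, hgc⟩ : Subgroup.closure (A : Set G))))
    obtain ⟨d, hd⟩ := Nat.dvd_factorial (Nat.pos_of_ne_zero hc0) (hcm rfl)
    rw [mem_ofPred_eq, hd, mul_right_comm, pow_mul, pow_mul, hpow, one_pow]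
  · push Not at hp
    obtain ⟨p, hp, hpinf⟩ := hp
    refine hX.false_of_forall_finset f hf hp.ne_one fun A m => ?_
    have := hfin A
    obtain ⟨g, hg, hgA⟩ := (hpinf.sdiff (toFinite (Subgroup.closure (A : Set G) : Set G))).nonempty
    refine ⟨g, fun c _ hgc => ?_⟩
    have hg : g ^ p = 1 := hg
    have hdvd : p ∣ c := by
      by_contra hpc
      refine hgA ?_
      obtain ⟨d, hd⟩ := exists_pow_eq_self_of_coprime
        (((hp.coprime_iff_not_dvd.2 hpc).coprime_dvd_left (orderOf_dvd_of_pow_eq_one hg)).symm)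
      exact hd ▸ pow_mem hgc d
    obtain ⟨d, rfl⟩ := hdvd
    exact ⟨dvd_mul_right _ _, by rw [pow_mul, hg, one_pow]⟩

end Groups

section Finiteness

variable {X : Type u} [Semigroup X] {z : X}

/-- In an absolutely `T₁S`-closed semigroup, the elements of the ideal center generating the same
ideal form a group, which is finite. -/
theorem AbsolutelyT1SClosed.finite_associates (hX : AbsolutelyT1SClosed X)
    (hz : z ∈ idealCenter X) : {w | (∃ x, w = z * x) ∧ ∃ u, z = w * u}.Finite := by
  classical
  set J : Set X := {w | (∃ x, w = z * x) ∧ ∃ u, z = w * u}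
  rcases J.eq_empty_or_nonempty with hJ | ⟨w₀, ⟨x₀, hx₀⟩, u₀, hu₀⟩
  · rw [hJ]
    exact finite_empty
  have hcomm := mul_right_comm_of_mem_idealCenter hz
  have hmem : ∀ x, z * x ∈ J ↔ ∃ u, z = z * x * u := fun x => ⟨And.right, fun h => ⟨⟨x, rfl⟩, h⟩⟩
  have hmul : ∀ x y, z * (x * y) ∈ J ↔ z * x ∈ J ∧ z * y ∈ J := by
    intro x y
    simp only [hmem]
    refine ⟨fun ⟨u, hu⟩ => ⟨⟨y * u, ?_⟩, ⟨x * u, ?_⟩⟩, fun ⟨⟨u, hu⟩, ⟨v, hv⟩⟩ => ⟨v * u, ?_⟩⟩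
    · simpa only [mul_assoc] using hu
    · rw [← mul_assoc, ← hcomm x y, mul_assoc z]
      exact hu
    · rw [mul_assoc z, mul_assoc x, ← mul_assoc y, ← mul_assoc z, hcomm, ← mul_assoc z, ← mul_assoc,
        ← hv, hcomm, ← hu]
  have hone : z = z * (x₀ * u₀) := by rw [← mul_assoc, ← hx₀, ← hu₀]
  have hzJ : z ∈ J := ⟨⟨_, hone⟩, _, hone⟩
  choose c hc using fun w : J => w.2.1
  choose d hd using fun w : J => w.2.2
  have hinv : ∀ w : J, z * d w ∈ J := fun w =>
    (hmem _).2 ⟨c w, by rw [hcomm, ← hc, ← hd]⟩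
  have hprod : ∀ w v : J, z * (c w * c v) ∈ J := fun w v =>
    (hmul _ _).2 ⟨hc w ▸ w.2, hc v ▸ v.2⟩
  let _ : Mul J := ⟨fun w v => ⟨_, hprod w v⟩⟩
  let _ : One J := ⟨⟨z, hzJ⟩⟩
  let _ : Inv J := ⟨fun w => ⟨_, hinv w⟩⟩
  have key : ∀ (w v : J) (x y : X), (w : X) = z * x → (v : X) = z * y →
      ((w * v : J) : X) = z * (x * y) := by
    intro w v x y hw hv
    change z * (c w * c v) = _
    rw [← mul_assoc, ← hc, hw, hcomm, ← hc, hv, hcomm, mul_assoc]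
  have hmul_comm : ∀ w v : J, w * v = v * w := fun w v => Subtype.ext <| by
    rw [key w v _ _ (hc w) (hc v), key v w _ _ (hc v) (hc w), ← mul_assoc, hcomm, mul_assoc]
  let _ : CommGroup J :=
    { Group.ofLeftAxioms (G := J)
        (fun w v t => Subtype.ext <| by
          rw [key _ t _ _ (key w v _ _ (hc w) (hc v)) (hc t),
            key w _ _ _ (hc w) (key v t _ _ (hc v) (hc t)), mul_assoc (c w)])
        (fun w => Subtype.ext <| by
          rw [key 1 w _ _ hone (hc w), ← mul_assoc, ← hone, ← hc])
        (fun w => Subtype.ext <| by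
          rw [key w⁻¹ w _ _ rfl (hc w), ← mul_assoc, hcomm, ← hc, ← hd]
          rfl) with
      mul_comm := hmul_comm }
  let f : X →ₙ* WithZero J :=
    { toFun := fun x => if h : z * x ∈ J then ((⟨z * x, h⟩ : J) : WithZero J) else 0
      map_mul' := fun x y => by
        by_cases hx : z * x ∈ J
        · by_cases hy : z * y ∈ J
          · rw [dif_pos hx, dif_pos hy, dif_pos ((hmul x y).2 ⟨hx, hy⟩), ← WithZero.coe_mul]
            exact congrArg _ (Subtype.ext (key _ _ x y rfl rfl).symm)
          · rw [dif_neg hy, dif_neg fun h => hy ((hmul x y).1 h).2, mul_zero]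
        · rw [dif_neg hx, dif_neg fun h => hx ((hmul x y).1 h).1, zero_mul] }
  refine finite_coe_iff.1 (hX.finite_group f fun w => ⟨c w, ?_⟩)
  exact (dif_pos (hc w ▸ w.2)).trans (congrArg _ (Subtype.ext (hc w).symm))

theorem AbsolutelyT1SClosed.finite_idealCenter (hX : AbsolutelyT1SClosed X) :
    Finite (idealCenter X) := by
  by_contra hinf
  have : Infinite (idealCenter X) := not_finite_iff_infinite.1 hinf
  let e := Infinite.natEmbedding (idealCenter X)
  obtain ⟨g, hg⟩ : ∃ g : ℕ ↪o ℕ, ∀ m n, m ≤ n → RLe (e (g m) : X) (e (g n)) := by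
    refine WellQuasiOrdered.exists_monotone_subseq
      (r := fun a b : idealCenter X => RLe (a : X) b) (fun s => ?_) e
    obtain ⟨m, n, hmn, h⟩ := hX.wellQuasiOrdered_jLe fun n => (s n : X)
    exact ⟨m, n, hmn, h.rLe (s n).2⟩
  let s : ℕ → X := fun n => e (g n)
  have hs : Function.Injective s := Subtype.val_injective.comp (e.injective.comp g.injective)
  have hstep : ∀ m, ∃ n, m ≤ n ∧ ¬ RLe (s n) (s m) := by
    intro m
    by_contra! h
    refine infinite_of_injective_forall_mem (f := fun n => s (m + n + 1))
      (fun a b hab => by simpa using hs hab) (fun n => ?_) (hX.finite_associates (e (g m)).2)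
    have hne : s m ≠ s (m + n + 1) := fun h => by
      have := hs h
      omega
    exact ⟨(h _ (by omega)).resolve_left hne.symm, (hg _ _ (by omega)).resolve_left hne⟩
  choose F hF hF' using hstep
  let φ : ℕ → ℕ := Nat.rec 0 fun _ m => F m
  obtain ⟨n, hn⟩ := hX.exists_rLe_succ (fun n => s (φ n)) (fun n => (e (g (φ n))).2)
    fun n => hg _ _ (hF (φ n))
  exact hF' (φ n) hn

end Finiteness

theorem statement3 (X : Type u) [Semigroup X] (hX : AbsolutelyT1SClosed X) :
    AbsolutelyT1SClosed ↥(idealCenter X) := by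
  have := hX.finite_idealCenter
  intro Y _ _ _ _ h
  exact (finite_range h).isClosed
end
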